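/- arXiv:1409.7647 — 9 statements merged into one kernel-verified Lean document; each statement's English description precedes it below -/
import Mathlib

section
/- Assume the cyclic constraints Σ_γ (ψ^γ_{is}ψ^γ_{jk} + ψ^γ_{js}ψ^γ_{ki} + ψ^γ_{ks}ψ^γ_{ij}) = 0 and Σ_γ (ω^γ_i ψ^γ_{jk} + ω^γ_j ψ^γ_{ki} + ω^γ_k ψ^γ_{ij}) = 0 for all indices i, j, k, s. Define g_{mk}(a) = Σ_γ ψ^γ_m(a)ψ^γ_k(a) and c_{ijk}(a) = −Σ_γ ψ^γ_i(a)ψ^γ_{jk}. Then: (i) c_{skm} = (1/3)(∂g_{sm}/∂a^k − ∂g_{sk}/∂a^m) everywhere on ℝⁿ; (ii) ∂g_{mk}/∂a^s + ∂g_{ks}/∂a^m + ∂g_{ms}/∂a^k = 0 everywhere on ℝⁿ; (iii) at every point a ∈ ℝⁿ at which Ψ(a) is invertible, the matrix g(a) is invertible and, denoting its inverse entries by g^{pq}(a), one has ∂c_{msk}/∂a^l = −g^{pq} c_{pml} c_{qsk}. That is, g satisfies the Potemin system characterizing homogeneous third-order Hamiltonian operators in Casimir coordinates. -/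
open scoped BigOperators

open Matrix in
/-- The quadratic form of the inverse Gram matrix `A * Aᵀ`, evaluated on vectors in the image
of `A`, is the standard dot product of their preimages. -/
theorem mulVec_dotProduct_gram_inv_mulVec {ι : Type*} [Fintype ι] [DecidableEq ι]
    {A : Matrix ι ι ℝ} (hA : IsUnit A) (v w : ι → ℝ) :
    (A *ᵥ v) ⬝ᵥ ((A * Aᵀ)⁻¹ *ᵥ (A *ᵥ w)) = v ⬝ᵥ w := by
  have hdet : IsUnit A.det := (A.isUnit_iff_isUnit_det).1 hA
  have hdet' : IsUnit Aᵀ.det := by rwa [det_transpose]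
  rw [Matrix.mul_inv_rev, mulVec_mulVec, Matrix.mul_assoc, nonsing_inv_mul _ hdet, Matrix.mul_one,
    dotProduct_mulVec, ← vecMul_transpose, vecMul_vecMul, mul_nonsing_inv _ hdet', vecMul_one]

/-- An affine function on `ι → ℝ` is differentiable, with partial derivatives its
coefficients. -/
theorem exists_hasFDerivAt_sum_mul_add {ι : Type*} [Fintype ι] [DecidableEq ι]
    (u : ι → ℝ) (b : ℝ) :
    ∃ D : (ι → ℝ) →L[ℝ] ℝ, (∀ l, D (Pi.single l 1) = u l) ∧
      ∀ a, HasFDerivAt (fun x : ι → ℝ => (∑ m, u m * x m) + b) D a :=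
  ⟨∑ m, u m • ContinuousLinearMap.proj (R := ℝ) (φ := fun _ : ι => ℝ) m,
    fun l => by simp [Pi.single_apply],
    fun a => (HasFDerivAt.fun_sum fun m _ => (hasFDerivAt_apply m a).const_mul (u m)).add_const b⟩

/-- Potemin system from the affine decomposition of the Monge metric
(Theorem on the metric decomposition, statement (i)-(iii)). -/
theorem potemin_from_decomposition
    (n : ℕ) (hn : 1 ≤ n)
    (ψ : Fin n → Fin n → Fin n → ℝ)   -- ψ^γ_{km} = ψ γ k m
    (ω : Fin n → Fin n → ℝ)           -- ω^γ_k = ω γ k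
    (hskew : ∀ γ k m, ψ γ k m = - ψ γ m k)
    (hcyc1 : ∀ i j k s,
      ∑ γ, (ψ γ i s * ψ γ j k + ψ γ j s * ψ γ k i + ψ γ k s * ψ γ i j) = 0)
    (hcyc2 : ∀ i j k,
      ∑ γ, (ω γ i * ψ γ j k + ω γ j * ψ γ k i + ω γ k * ψ γ i j) = 0)
    (ψa : Fin n → Fin n → (Fin n → ℝ) → ℝ)   -- affine functions ψ^γ_k(a)
    (hψa : ∀ γ k a, ψa γ k a = (∑ m, ψ γ k m * a m) + ω γ k)
    (Ψ : (Fin n → ℝ) → Matrix (Fin n) (Fin n) ℝ)  -- row k, column γ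
    (hΨ : ∀ a k γ, Ψ a k γ = ψa γ k a)
    (g : Fin n → Fin n → (Fin n → ℝ) → ℝ)
    (hg : ∀ m k a, g m k a = ∑ γ, ψa γ m a * ψa γ k a)
    (c : Fin n → Fin n → Fin n → (Fin n → ℝ) → ℝ)
    (hc : ∀ i j k a, c i j k a = - ∑ γ, ψa γ i a * ψ γ j k) :
    -- (i)  c_{skm} = (1/3)(∂_k g_{sm} − ∂_m g_{sk})
    (∀ s k m (a : Fin n → ℝ),
      c s k m a = (1/3) * (fderiv ℝ (g s m) a (Pi.single k 1)
                            - fderiv ℝ (g s k) a (Pi.single m 1)))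
    ∧
    -- (ii)  Monge condition
    (∀ m k s (a : Fin n → ℝ),
      fderiv ℝ (g m k) a (Pi.single s 1) + fderiv ℝ (g k s) a (Pi.single m 1)
        + fderiv ℝ (g m s) a (Pi.single k 1) = 0)
    ∧
    -- (iii)  nonlinear Potemin condition at points where Ψ(a) is invertible
    (∀ a : Fin n → ℝ, IsUnit (Ψ a) →
      IsUnit (Matrix.of (fun i j => g i j a)) ∧
      ∀ m s k l, fderiv ℝ (c m s k) a (Pi.single l 1)
        = - ∑ p, ∑ q, (Matrix.of (fun i j => g i j a))⁻¹ p q * c p m l a * c q s k a) := by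
  choose D hD hψd using fun γ k => exists_hasFDerivAt_sum_mul_add (ψ γ k) (ω γ k)
  simp only [← hψa] at hψd
  have hc_swap (i j k a) : c i j k a = - c i k j a := by
    simp only [hc, ← Finset.sum_neg_distrib]
    exact Finset.sum_congr rfl fun γ _ => by rw [hskew γ j k]; ring
  have hc_cyc (i j k a) : c i j k a + c j k i a + c k i j a = 0 := by
    have key : ∑ γ, (ψa γ i a * ψ γ j k + ψa γ j a * ψ γ k i + ψa γ k a * ψ γ i j)
        = (∑ s, a s * ∑ γ, (ψ γ i s * ψ γ j k + ψ γ j s * ψ γ k i + ψ γ k s * ψ γ i j))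
          + ∑ γ, (ω γ i * ψ γ j k + ω γ j * ψ γ k i + ω γ k * ψ γ i j) := by
      simp only [Finset.mul_sum]
      rw [Finset.sum_comm, ← Finset.sum_add_distrib]
      refine Finset.sum_congr rfl fun γ _ => ?_
      have expand (p q : Fin n → ℝ) (x : ℝ) :
          (∑ s, p s * q s) * x = ∑ s, q s * (p s * x) := by
        rw [Finset.sum_mul]
        exact Finset.sum_congr rfl fun s _ => by ring
      simp only [hψa, add_mul, expand, mul_add, Finset.sum_add_distrib]
      ring
    simp only [hcyc1, hcyc2, mul_zero, Finset.sum_const_zero, add_zero,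
      Finset.sum_add_distrib] at key
    simp only [hc]
    linarith
  have hg_deriv (m k s a) :
      fderiv ℝ (g m k) a (Pi.single s 1) = - c m k s a - c k m s a := by
    have h := HasFDerivAt.fun_sum (u := Finset.univ) fun γ _ => (hψd γ m a).fun_mul (hψd γ k a)
    rw [show g m k = _ from funext (hg m k), HasFDerivAt.fderiv h]
    simp [hc, hD, Finset.sum_add_distrib]
  have hc_deriv (m s k l a) :
      fderiv ℝ (c m s k) a (Pi.single l 1) = - ∑ γ, ψ γ m l * ψ γ s k := by
    have h := (HasFDerivAt.fun_sum (u := Finset.univ) fun γ _ =>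
      (hψd γ m a).mul_const (ψ γ s k)).fun_neg
    rw [show c m s k = _ from funext (hc m s k), HasFDerivAt.fderiv h]
    simp [hD, mul_comm]
  refine ⟨fun s k m a => ?_, fun m k s a => ?_, fun a ha => ?_⟩
  · rw [hg_deriv, hg_deriv]
    linarith [hc_cyc s k m a, hc_swap s m k a, hc_swap k m s a, hc_swap m s k a]
  · rw [hg_deriv, hg_deriv, hg_deriv]
    linarith [hc_swap m k s a, hc_swap k m s a, hc_swap s m k a]
  · have hG : Matrix.of (fun i j => g i j a) = Ψ a * (Ψ a).transpose := by
      ext i j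
      simp [Matrix.mul_apply, hg, hΨ]
    have hcv (j k) : (fun p => c p j k a) = (Ψ a).mulVec (fun γ => - ψ γ j k) := by
      ext p
      simp [Matrix.mulVec, dotProduct, hc, hΨ]
    rw [hG]
    refine ⟨ha.mul ((Matrix.isUnit_transpose _).2 ha), fun m s k l => ?_⟩
    have key := mulVec_dotProduct_gram_inv_mulVec ha (fun γ => - ψ γ m l) (fun γ => - ψ γ s k)
    rw [← hcv, ← hcv] at key
    rw [hc_deriv]
    simp only [dotProduct, Matrix.mulVec, Finset.mul_sum, neg_mul_neg] at key
    rw [← key]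
    exact congrArg _ (Finset.sum_congr rfl fun p _ => Finset.sum_congr rfl fun q _ => by ring)
end

section
/- (i) For each α = 1, …, n and every smooth curve b: ℝ → ℝⁿ, the Euler–Lagrange derivative of the density s^α(b, b_x) = (½ ψ^α_{mk} b_x^k + ω^α_m) b^m satisfies E_s(s^α)(x) = ψ^α_{sm} b'^m(x) + ω^α_s = ψ^α_s(b'(x)) for all s and x. (ii) Consequently, if in addition Ψ(b'(x)) is invertible for every x, with inverse entries denoted ψ^i_γ(b'(x)), then for any real constants φ^{βγ} one has Σ_{β,γ,s} φ^{βγ} ψ^i_β(b'(x)) · (d/dx)[ψ^s_γ(b'(x)) E_s(s^α)(x)] = 0 for all i, α, x; i.e. the functionals S^α = ∫ s^α dx are nonlocal Casimirs of the factorised third-order Hamiltonian operator. -/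
open scoped BigOperators

/-- Euler–Lagrange (variational) derivative of a density `h(b, b_x)` along a curve `b`. -/
noncomputable def ELd {n : ℕ} (h : (Fin n → ℝ) → (Fin n → ℝ) → ℝ)
    (b : ℝ → Fin n → ℝ) (s : Fin n) (x : ℝ) : ℝ :=
  fderiv ℝ (fun u => h u (deriv b x)) (b x) (Pi.single s 1)
  - deriv (fun y => fderiv ℝ (fun v => h (b y) v) (deriv b y) (Pi.single s 1)) x

theorem Matrix.differentiable_det {n : Type*} [Fintype n] [DecidableEq n]
    {A : ℝ → Matrix n n ℝ} (hA : ∀ i j, Differentiable ℝ fun x => A x i j) :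
    Differentiable ℝ fun x => (A x).det := by
  simp only [Matrix.det_apply']
  fun_prop

theorem Matrix.differentiable_inv_apply {n : Type*} [Fintype n] [DecidableEq n]
    {A : ℝ → Matrix n n ℝ} (hA : ∀ i j, Differentiable ℝ fun x => A x i j)
    (hu : ∀ x, IsUnit (A x)) (i j : n) :
    Differentiable ℝ fun x => (A x)⁻¹ i j := by
  have hdet : ∀ x, (A x).det ≠ 0 := fun x =>
    ((Matrix.isUnit_iff_isUnit_det _).1 (hu x)).ne_zero
  simp only [Matrix.inv_def, Ring.inverse_eq_inv', Matrix.smul_apply, smul_eq_mul,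
    Matrix.adjugate_apply]
  refine (Differentiable.inv (differentiable_det hA) hdet).mul (differentiable_det fun k l => ?_)
  by_cases hk : k = j
  · subst hk
    simp
  · simpa [Matrix.updateRow_ne hk] using hA k l

theorem fderiv_sum_mul_apply_single {ι : Type*} [Fintype ι] [DecidableEq ι]
    (c : ι → ℝ) (d : ℝ) (u : ι → ℝ) (s : ι) :
    fderiv ℝ (fun v : ι → ℝ => ∑ m, c m * v m + d) u (Pi.single s 1) = c s := by
  have h : HasFDerivAt (fun v : ι → ℝ => ∑ m, c m * v m + d)
      (∑ m, c m • ContinuousLinearMap.proj (R := ℝ) (φ := fun _ : ι => ℝ) m) u :=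
    (HasFDerivAt.fun_sum fun m _ => (hasFDerivAt_apply m u).const_mul (c m)).add_const d
  rw [h.fderiv]
  simp [Pi.single_apply]

/-- Nonlocal Casimirs of the factorised third-order Hamiltonian operator. -/
theorem nonlocal_casimirs
    (n : ℕ) (hn : 1 ≤ n)
    (ψ : Fin n → Fin n → Fin n → ℝ)   -- ψ^γ_{km} = ψ γ k m
    (ω : Fin n → Fin n → ℝ)           -- ω^γ_k = ω γ k
    (hskew : ∀ γ k m, ψ γ k m = - ψ γ m k)
    (Ψ : (Fin n → ℝ) → Matrix (Fin n) (Fin n) ℝ)  -- row k, column γ: ψ^γ_k(a)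
    (hΨ : ∀ a k γ, Ψ a k γ = (∑ m, ψ γ k m * a m) + ω γ k)
    (sdens : Fin n → (Fin n → ℝ) → (Fin n → ℝ) → ℝ)
    (hsdens : ∀ α b bx, sdens α b bx = ∑ m, ((1/2) * (∑ k, ψ α m k * bx k) + ω α m) * b m)
    (b : ℝ → Fin n → ℝ) (hb : ContDiff ℝ (⊤ : ℕ∞) b) :
    -- (i)  E_s(s^α)(x) = ψ^α_s(b'(x))
    (∀ α s x, ELd (sdens α) b s x = (∑ m, ψ α s m * deriv b x m) + ω α s)
    ∧
    -- (ii)  the functionals S^α are Casimirs of the factorised operator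
    ((∀ x, IsUnit (Ψ (deriv b x))) →
      ∀ φ : Fin n → Fin n → ℝ, ∀ i α x,
        ∑ β, ∑ γ, ∑ s, φ β γ * (Ψ (deriv b x))⁻¹ β i *
          deriv (fun y => (Ψ (deriv b y))⁻¹ γ s * ELd (sdens α) b s y) x = 0) := by
  have hb₁ : Differentiable ℝ b := hb.differentiable (by simp)
  have hb₂ : Differentiable ℝ (deriv b) :=
    ((contDiff_infty_iff_deriv.1 hb).2).differentiable (by simp)
  have euler : ∀ α s x, ELd (sdens α) b s x = (∑ m, ψ α s m * deriv b x m) + ω α s := by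
    intro α s x
    have hu : (fun u => sdens α u (deriv b x)) = fun u =>
        ∑ m, ((1/2) * (∑ k, ψ α m k * deriv b x k) + ω α m) * u m + 0 := by
      funext u
      rw [hsdens, add_zero]
    have hv : ∀ y, (fun v => sdens α (b y) v) = fun v =>
        ∑ k, ((1/2) * ∑ m, ψ α m k * b y m) * v k + ∑ m, ω α m * b y m := by
      intro y
      funext v
      simp only [hsdens, add_mul, Finset.sum_add_distrib, Finset.mul_sum, Finset.sum_mul]
      rw [Finset.sum_comm]
      congr 1
      exact Finset.sum_congr rfl fun k _ => Finset.sum_congr rfl fun m _ => by ring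
    have hd : HasDerivAt (fun y => (1/2) * ∑ m, ψ α m s * b y m)
        ((1/2) * ∑ m, ψ α m s * deriv b x m) x :=
      (HasDerivAt.fun_sum fun m _ =>
        (hasDerivAt_pi.1 (hb₁ x).hasDerivAt m).const_mul (ψ α m s)).const_mul _
    have hsum : ∑ m, ψ α m s * deriv b x m = - ∑ m, ψ α s m * deriv b x m := by
      rw [← Finset.sum_neg_distrib]
      exact Finset.sum_congr rfl fun m _ => by rw [hskew α m s, neg_mul]
    simp only [ELd, hu, hv, fderiv_sum_mul_apply_single]
    rw [hd.deriv, hsum]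
    ring
  refine ⟨euler, fun hunit φ i α x => ?_⟩
  have hentry : ∀ k γ, Differentiable ℝ fun y => Ψ (deriv b y) k γ := by
    intro k γ
    simp only [hΨ]
    fun_prop
  refine Finset.sum_eq_zero fun β _ => Finset.sum_eq_zero fun γ _ => ?_
  simp only [euler, ← hΨ]
  rw [← Finset.mul_sum, ← deriv_fun_sum fun s _ =>
    ((Matrix.differentiable_inv_apply hentry hunit γ s).fun_mul (hentry s α)) x]
  have hconst : ∀ y, ∑ s, (Ψ (deriv b y))⁻¹ γ s * Ψ (deriv b y) s α =
      (1 : Matrix (Fin n) (Fin n) ℝ) γ α := by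
    intro y
    rw [← Matrix.mul_apply,
      Matrix.nonsing_inv_mul _ ((Matrix.isUnit_iff_isUnit_det _).1 (hunit y))]
  simp only [hconst, deriv_const, mul_zero]
end

section
/- Define the momentum density P(b, b_x) = −(⅓ φ_{βγ} ω^β_q ψ^γ_{pm} b_x^m + ½ φ_{βγ} ω^β_p ω^γ_q) b^p b^q (summation over all repeated indices). Then for every smooth curve b: ℝ → ℝⁿ such that Ψ(b'(x)) is invertible for every x, with inverse entries denoted ψ^i_γ(b'(x)), one has −Σ_{β,γ,s} φ^{βγ} ψ^i_β(b'(x)) · (d/dx)[ψ^s_γ(b'(x)) E_s(P)(x)] = b'^i(x) for all i and x; i.e. P = ∫ P dx is the momentum of the factorised third-order Hamiltonian structure. -/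
open scoped BigOperators

/-- Pull a double sum out of a contraction. -/
lemma sum_sum_mul_comm {n : ℕ} (g : Fin n → Fin n → Fin n → ℝ) (v : Fin n → ℝ) :
    ∑ m, (∑ p, ∑ q, g p q m) * v m = ∑ p, ∑ q, ∑ m, g p q m * v m := by
  simp only [Finset.sum_mul]
  rw [Finset.sum_comm]
  exact Finset.sum_congr rfl fun p _ => Finset.sum_comm

lemma DifferentiableAt.matrix_det {n : ℕ} {M : ℝ → Matrix (Fin n) (Fin n) ℝ} {x : ℝ}
    (h : ∀ i j, DifferentiableAt ℝ (fun y => M y i j) x) :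
    DifferentiableAt ℝ (fun y => (M y).det) x := by
  simp only [Matrix.det_apply']
  exact DifferentiableAt.fun_sum fun σ _ =>
    (DifferentiableAt.fun_finsetProd fun i _ => h (σ i) i).const_mul _

/-- The entries of the inverse of a differentiable family of invertible matrices are
differentiable. -/
lemma DifferentiableAt.matrix_inv_apply {n : ℕ} {M : ℝ → Matrix (Fin n) (Fin n) ℝ} {x : ℝ}
    (h : ∀ i j, DifferentiableAt ℝ (fun y => M y i j) x) (hx : IsUnit (M x)) (i j : Fin n) :
    DifferentiableAt ℝ (fun y => (M y)⁻¹ i j) x := by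
  have hdet : (M x).det ≠ 0 := ((Matrix.isUnit_iff_isUnit_det _).1 hx).ne_zero
  simp only [Matrix.inv_def, Matrix.smul_apply, smul_eq_mul, Ring.inverse_eq_inv',
    Matrix.adjugate_apply]
  refine ((DifferentiableAt.matrix_det h).inv hdet).mul (DifferentiableAt.matrix_det fun k l => ?_)
  by_cases hk : k = j
  · simp [Matrix.updateRow_apply, hk]
  · simpa [Matrix.updateRow_apply, hk] using h k l

/-- Derivative of a quadratic form in a coordinate direction. -/
lemma fderiv_quadratic_single {n : ℕ} (c : Fin n → Fin n → ℝ) (a : Fin n → ℝ) (s : Fin n) :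
    fderiv ℝ (fun u : Fin n → ℝ => ∑ p, ∑ q, c p q * u p * u q) a (Pi.single s 1)
      = ∑ q, (c s q + c q s) * a q := by
  have h : HasFDerivAt (fun u : Fin n → ℝ => ∑ p, ∑ q, c p q * u p * u q)
      (∑ p, ∑ q, ((c p q * a p) • ContinuousLinearMap.proj (R := ℝ) (φ := fun _ : Fin n => ℝ) q
        + a q • (c p q • ContinuousLinearMap.proj (R := ℝ) (φ := fun _ : Fin n => ℝ) p))) a :=
    HasFDerivAt.fun_sum fun p _ => HasFDerivAt.fun_sum fun q _ =>
      ((hasFDerivAt_apply p a).const_mul (c p q)).mul (hasFDerivAt_apply q a)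
  rw [h.fderiv]
  simp only [FunLike.coe_sum, Finset.sum_apply, add_apply,
    smul_apply, ContinuousLinearMap.proj_apply, smul_eq_mul, Pi.single_apply,
    mul_ite, mul_one, mul_zero, Finset.sum_add_distrib, add_mul, Finset.sum_ite_eq',
    Finset.mem_univ, if_true]
  rw [add_comm]
  congr 1
  rw [Finset.sum_comm]
  simp [mul_comm]

/-- Derivative of an affine function in a coordinate direction. -/
lemma fderiv_affine_single {n : ℕ} (c : Fin n → ℝ) (k : ℝ) (a : Fin n → ℝ) (s : Fin n) :
    fderiv ℝ (fun v : Fin n → ℝ => ∑ m, c m * v m + k) a (Pi.single s 1) = c s := by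
  have h : HasFDerivAt (fun v : Fin n → ℝ => ∑ m, c m * v m + k)
      (∑ m, c m • ContinuousLinearMap.proj (R := ℝ) (φ := fun _ : Fin n => ℝ) m) a :=
    (HasFDerivAt.fun_sum fun m _ => (hasFDerivAt_apply m a).const_mul (c m)).add_const k
  rw [h.fderiv]
  simp [Pi.single_apply]

/-- The Euler–Lagrange derivative of a density quadratic in `b` and affine in `b_x`. The cubic part
contributes a single term thanks to the cyclic identity. -/
lemma ELd_quadratic_affine {n : ℕ} (A : Fin n → Fin n → Fin n → ℝ) (W : Fin n → Fin n → ℝ)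
    (hA : ∀ q p m, A q p m = -A q m p)
    (hcyc : ∀ i j k, A i j k + A j k i + A k i j = 0)
    (hW : ∀ p q, W p q = W q p)
    (b : ℝ → Fin n → ℝ) (hb : Differentiable ℝ b) (s : Fin n) (x : ℝ) :
    ELd (fun u v => ∑ p, ∑ q, (-(1/3) * ∑ m, A q p m * v m - 1/2 * W p q) * u p * u q) b s x
      = -∑ q, (∑ m, A q s m * deriv b x m + W s q) * b x q := by
  have hv : ∀ y, fderiv ℝ (fun v : Fin n → ℝ =>
      ∑ p, ∑ q, (-(1/3) * ∑ m, A q p m * v m - 1/2 * W p q) * b y p * b y q)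
        (deriv b y) (Pi.single s 1) = ∑ p, ∑ q, -(1/3) * A q p s * b y p * b y q := by
    intro y
    rw [← fderiv_affine_single (fun m => ∑ p, ∑ q, -(1/3) * A q p m * b y p * b y q)
      (∑ p, ∑ q, -(1/2) * W p q * b y p * b y q) (deriv b y) s]
    congr 2
    funext v
    rw [sum_sum_mul_comm, ← Finset.sum_add_distrib]
    refine Finset.sum_congr rfl fun p _ => ?_
    rw [← Finset.sum_add_distrib]
    refine Finset.sum_congr rfl fun q _ => ?_
    have h : ∑ m, -(1/3) * A q p m * b y p * b y q * v m
        = -(1/3) * (∑ m, A q p m * v m) * b y p * b y q := by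
      simp only [Finset.mul_sum, Finset.sum_mul]
      exact Finset.sum_congr rfl fun m _ => by ring
    rw [h]
    ring
  have hbc : ∀ p, HasDerivAt (fun y => b y p) (deriv b x p) x := fun p =>
    hasDerivAt_pi.1 (hb x).hasDerivAt p
  have hd : HasDerivAt (fun y => ∑ p, ∑ q, -(1/3) * A q p s * b y p * b y q)
      (∑ p, ∑ q, (-(1/3) * A q p s * deriv b x p * b x q
        + -(1/3) * A q p s * b x p * deriv b x q)) x :=
    HasDerivAt.fun_sum fun p _ => HasDerivAt.fun_sum fun q _ =>
      ((hbc p).const_mul _).mul (hbc q)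
  unfold ELd
  simp only [hv]
  rw [hd.deriv, fderiv_quadratic_single]
  simp only [Finset.sum_add_distrib]
  rw [Finset.sum_comm (f := fun p q => -(1/3) * A q p s * deriv b x p * b x q),
    ← Finset.sum_add_distrib, ← Finset.sum_sub_distrib, ← Finset.sum_neg_distrib]
  refine Finset.sum_congr rfl fun q _ => ?_
  have key : ∑ m, A q s m * deriv b x m
      = 1/3 * (∑ m, A q s m * deriv b x m) + 1/3 * (∑ m, A s q m * deriv b x m)
        - 1/3 * (∑ m, A q m s * deriv b x m) - 1/3 * ∑ m, A m q s * deriv b x m := by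
    simp only [Finset.mul_sum]
    rw [← Finset.sum_add_distrib, ← Finset.sum_sub_distrib, ← Finset.sum_sub_distrib]
    refine Finset.sum_congr rfl fun m _ => ?_
    linear_combination (1/3 * deriv b x m) * (hcyc q s m + hA q m s - hA s q m)
  have h1 : ∑ p, -(1/3) * A q p s * deriv b x p * b x q
      = -(1/3) * (∑ m, A q m s * deriv b x m) * b x q := by
    simp only [Finset.mul_sum, Finset.sum_mul]
    exact Finset.sum_congr rfl fun m _ => by ring
  have h2 : ∑ p, -(1/3) * A p q s * b x q * deriv b x p
      = -(1/3) * (∑ m, A m q s * deriv b x m) * b x q := by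
    simp only [Finset.mul_sum, Finset.sum_mul]
    exact Finset.sum_congr rfl fun m _ => by ring
  rw [h1, h2, hW q s]
  linear_combination b x q * key

/-- The momentum of the factorised third-order Hamiltonian structure. -/
theorem momentum_of_factorised_structure
    (n : ℕ) (hn : 1 ≤ n)
    (ψ : Fin n → Fin n → Fin n → ℝ)   -- ψ^γ_{km} = ψ γ k m
    (ω : Fin n → Fin n → ℝ)           -- ω^γ_k = ω γ k
    (hskew : ∀ γ k m, ψ γ k m = - ψ γ m k)
    (Φ : Matrix (Fin n) (Fin n) ℝ)
    (hΦsym : ∀ β γ, Φ β γ = Φ γ β)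
    (hΦunit : IsUnit Φ)
    (hconstr : ∀ i j k, ∑ β, ∑ γ,
      Φ β γ * (ω β i * ψ γ j k + ω β j * ψ γ k i + ω β k * ψ γ i j) = 0)
    (Ψ : (Fin n → ℝ) → Matrix (Fin n) (Fin n) ℝ)  -- row k, column γ: ψ^γ_k(a)
    (hΨ : ∀ a k γ, Ψ a k γ = (∑ m, ψ γ k m * a m) + ω γ k)
    (P : (Fin n → ℝ) → (Fin n → ℝ) → ℝ)
    (hP : ∀ b bx, P b bx = - ∑ p, ∑ q,
      ((1/3) * (∑ β, ∑ γ, Φ β γ * ω β q * (∑ m, ψ γ p m * bx m))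
        + (1/2) * (∑ β, ∑ γ, Φ β γ * ω β p * ω γ q)) * b p * b q)
    (b : ℝ → Fin n → ℝ) (hb : ContDiff ℝ (⊤ : ℕ∞) b)
    (hinv : ∀ x, IsUnit (Ψ (deriv b x))) :
    ∀ i x, -(∑ β, ∑ γ, ∑ s, Φ⁻¹ β γ * (Ψ (deriv b x))⁻¹ β i *
        deriv (fun y => (Ψ (deriv b y))⁻¹ γ s * ELd P b s y) x) = deriv b x i := by
  set A : Fin n → Fin n → Fin n → ℝ := fun q p m => ∑ β, ∑ γ, Φ β γ * ω β q * ψ γ p m with hAdef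
  set W : Fin n → Fin n → ℝ := fun p q => ∑ β, ∑ γ, Φ β γ * ω β p * ω γ q with hWdef
  have hA : ∀ q p m, A q p m = -A q m p := by
    intro q p m
    simp only [hAdef, ← Finset.sum_neg_distrib]
    refine Finset.sum_congr rfl fun β _ => Finset.sum_congr rfl fun γ _ => ?_
    rw [hskew γ p m]
    ring
  have hcyc : ∀ i j k, A i j k + A j k i + A k i j = 0 := by
    intro i j k
    rw [← hconstr i j k]
    simp only [hAdef, ← Finset.sum_add_distrib]
    refine Finset.sum_congr rfl fun β _ => Finset.sum_congr rfl fun γ _ => ?_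
    ring
  have hW : ∀ p q, W p q = W q p := by
    intro p q
    simp only [hWdef]
    rw [Finset.sum_comm]
    refine Finset.sum_congr rfl fun β _ => Finset.sum_congr rfl fun γ _ => ?_
    rw [hΦsym γ β]
    ring
  have hcontract : ∀ (v : Fin n → ℝ) q p,
      ∑ β, ∑ γ, Φ β γ * ω β q * (∑ m, ψ γ p m * v m) = ∑ m, A q p m * v m := by
    intro v q p
    simp only [hAdef, sum_sum_mul_comm, Finset.mul_sum, mul_assoc]
  have hPeq : P = fun u v =>
      ∑ p, ∑ q, (-(1/3) * ∑ m, A q p m * v m - 1/2 * W p q) * u p * u q := by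
    funext u v
    rw [hP]
    simp only [hcontract, ← Finset.sum_neg_distrib]
    exact Finset.sum_congr rfl fun p _ => Finset.sum_congr rfl fun q _ => by
      simp only [hWdef]; ring
  have hbd : Differentiable ℝ b := hb.differentiable (by simp)
  have hEL : ∀ y, (fun s => ELd P b s y)
      = -(Ψ (deriv b y)).mulVec (fun γ => ∑ q, (∑ β, Φ β γ * ω β q) * b y q) := by
    intro y
    funext s
    rw [hPeq, ELd_quadratic_affine A W hA hcyc hW b hbd s y, Pi.neg_apply]
    congr 1
    simp only [Matrix.mulVec, dotProduct, Finset.mul_sum]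
    rw [Finset.sum_comm]
    refine Finset.sum_congr rfl fun q _ => ?_
    rw [hW s q, ← hcontract]
    simp only [hWdef, ← Finset.sum_add_distrib, Finset.sum_mul, Finset.mul_sum, hΨ]
    rw [Finset.sum_comm]
    refine Finset.sum_congr rfl fun γ _ => Finset.sum_congr rfl fun β _ => ?_
    rw [← Finset.mul_sum]
    ring
  have hflux : ∀ γ y, ∑ s, (Ψ (deriv b y))⁻¹ γ s * ELd P b s y
      = -∑ q, (∑ β, Φ β γ * ω β q) * b y q := by
    intro γ y
    have hdet := (Matrix.isUnit_iff_isUnit_det _).1 (hinv y)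
    have := congrFun (congrArg (Ψ (deriv b y))⁻¹.mulVec (hEL y)) γ
    rwa [Matrix.mulVec_neg, Matrix.mulVec_mulVec, Matrix.nonsing_inv_mul _ hdet,
      Matrix.one_mulVec] at this
  have hb' : Differentiable ℝ (deriv b) :=
    ((contDiff_infty_iff_deriv.1 hb).2).differentiable (by simp)
  have hΨd : ∀ x k γ, DifferentiableAt ℝ (fun y => Ψ (deriv b y) k γ) x := by
    intro x k γ
    simp only [hΨ]
    exact (DifferentiableAt.fun_sum fun m _ =>
      (differentiableAt_pi.1 (hb' x) m).const_mul _).add_const _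
  have hELd : ∀ x s, DifferentiableAt ℝ (fun y => ELd P b s y) x := by
    intro x s
    have h : (fun y => ELd P b s y) = fun y =>
        -∑ γ, Ψ (deriv b y) s γ * ∑ q, (∑ β, Φ β γ * ω β q) * b y q :=
      funext fun y => congrFun (hEL y) s
    rw [h]
    exact (DifferentiableAt.fun_sum fun γ _ => (hΨd x s γ).mul (DifferentiableAt.fun_sum
      fun q _ => (differentiableAt_pi.1 (hbd x) q).const_mul _)).neg
  intro i x
  have hderiv : ∀ γ, ∑ s, deriv (fun y => (Ψ (deriv b y))⁻¹ γ s * ELd P b s y) x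
      = -∑ δ, Φ γ δ * ∑ q, ω δ q * deriv b x q := by
    intro γ
    rw [← deriv_fun_sum fun s _ =>
      (DifferentiableAt.matrix_inv_apply (hΨd x) (hinv x) γ s).fun_mul (hELd x s)]
    simp only [hflux]
    have h : HasDerivAt (fun y => -∑ q, (∑ β, Φ β γ * ω β q) * b y q)
        (-∑ q, (∑ β, Φ β γ * ω β q) * deriv b x q) x :=
      (HasDerivAt.fun_sum fun q _ =>
        (hasDerivAt_pi.1 (hbd x).hasDerivAt q).const_mul _).neg
    rw [h.deriv]
    simp only [Finset.sum_mul, Finset.mul_sum]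
    rw [Finset.sum_comm]
    simp only [hΦsym γ, mul_assoc]
  have hΨv : ∀ β, ∑ q, ω β q * deriv b x q = Matrix.vecMul (deriv b x) (Ψ (deriv b x)) β := by
    intro β
    have hz : ∑ q, ∑ m, deriv b x q * (ψ β q m * deriv b x m) = 0 := by
      have h : ∑ q, ∑ m, deriv b x q * (ψ β q m * deriv b x m)
          = -∑ q, ∑ m, deriv b x q * (ψ β q m * deriv b x m) := by
        conv_lhs => rw [Finset.sum_comm]
        simp only [← Finset.sum_neg_distrib]
        refine Finset.sum_congr rfl fun q _ => Finset.sum_congr rfl fun m _ => ?_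
        rw [hskew β m q]
        ring
      linarith
    simp only [Matrix.vecMul, dotProduct, hΨ, mul_add, Finset.sum_add_distrib, Finset.mul_sum, hz,
      zero_add]
    exact Finset.sum_congr rfl fun q _ => mul_comm _ _
  have hΦdet := (Matrix.isUnit_iff_isUnit_det _).1 hΦunit
  have hΨdet := (Matrix.isUnit_iff_isUnit_det _).1 (hinv x)
  have hΦw : ∀ w : Fin n → ℝ, ∀ β, ∑ γ, Φ⁻¹ β γ * ∑ δ, Φ γ δ * w δ = w β := by
    intro w β
    have h := congrFun (Matrix.mulVec_mulVec w Φ⁻¹ Φ) β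
    rwa [Matrix.nonsing_inv_mul _ hΦdet, Matrix.one_mulVec] at h
  calc _ = ∑ β, (Ψ (deriv b x))⁻¹ β i *
        ∑ γ, Φ⁻¹ β γ * ∑ δ, Φ γ δ * ∑ q, ω δ q * deriv b x q := by
        rw [← Finset.sum_neg_distrib]
        refine Finset.sum_congr rfl fun β _ => ?_
        rw [← Finset.sum_neg_distrib, Finset.mul_sum]
        refine Finset.sum_congr rfl fun γ _ => ?_
        rw [← Finset.mul_sum, hderiv]
        ring
    _ = ∑ β, Matrix.vecMul (deriv b x) (Ψ (deriv b x)) β * (Ψ (deriv b x))⁻¹ β i := by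
        refine Finset.sum_congr rfl fun β _ => ?_
        rw [hΦw, hΨv, mul_comm]
    _ = deriv b x i := by
        have h := congrFun (Matrix.vecMul_vecMul (deriv b x) (Ψ (deriv b x)) (Ψ (deriv b x))⁻¹) i
        rwa [Matrix.mul_nonsing_inv _ hΨdet, Matrix.vecMul_one] at h
end

section
/- Define ζ_{kpq} = (1/3) φ_{βγ}(ψ^β_{kp} η^γ_q + 2 ψ^β_{qk} η^γ_p). Then ζ_{kpq} is symmetric in its first two indices k, p. Define the Hamiltonian density h(b, b_x) = ½ (ζ_{pqm} b_x^m − φ_{βγ} ω^β_p η^γ_q) b^p b^q. Then for every smooth curve b: ℝ → ℝⁿ such that Ψ(b'(x)) is invertible for every x, with inverse entries denoted ψ^i_γ(b'(x)), one has −Σ_{β,γ,s} φ^{βγ} ψ^i_β(b'(x)) · (d/dx)[ψ^s_γ(b'(x)) E_s(h)(x)] = ψ^i_γ(b'(x)) η^γ_m b'^m(x) for all i and x. In other words, the non-diagonalizable hydrodynamic type system b_t^i = v^i(b_x), with v^i(a) = ψ^i_γ(a) η^γ_m a^m, is Hamiltonian with Hamiltonian density h with respect to the factorised third-order Hamiltonian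 operator. -/
open scoped BigOperators

/-- A finite-dimensional matrix determinant is differentiable when all entries are. -/
theorem differentiableAt_matrix_det {n : ℕ} {A : ℝ → Matrix (Fin n) (Fin n) ℝ} {x : ℝ}
    (hA : ∀ i j, DifferentiableAt ℝ (fun y => A y i j) x) :
    DifferentiableAt ℝ (fun y => (A y).det) x := by
  simp only [Matrix.det_apply']
  refine DifferentiableAt.fun_sum fun σ _ => DifferentiableAt.const_mul ?_ _
  exact DifferentiableAt.fun_finsetProd fun i _ => hA _ _

/-- The entries of the inverse of a differentiable family of invertible matrices are
differentiable. -/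
theorem differentiableAt_matrix_inv_apply {n : ℕ} {A : ℝ → Matrix (Fin n) (Fin n) ℝ} {x : ℝ}
    (hA : ∀ i j, DifferentiableAt ℝ (fun y => A y i j) x) (hx : IsUnit (A x)) (i j : Fin n) :
    DifferentiableAt ℝ (fun y => (A y)⁻¹ i j) x := by
  have hdet : (A x).det ≠ 0 := ((Matrix.isUnit_iff_isUnit_det _).1 hx).ne_zero
  simp only [Matrix.inv_def, Ring.inverse_eq_inv', Matrix.smul_apply, smul_eq_mul,
    Matrix.adjugate_apply]
  refine ((differentiableAt_matrix_det hA).inv hdet).mul (differentiableAt_matrix_det fun k l => ?_)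
  by_cases hk : k = j
  · simp [Matrix.updateRow_apply, hk]
  · simpa [Matrix.updateRow_apply, hk] using hA k l

/-- Partial derivatives of a quadratic form with symmetric coefficients. -/
theorem fderiv_half_quadratic_single {n : ℕ} {S : Fin n → Fin n → ℝ}
    (hS : ∀ p q, S p q = S q p) (u : Fin n → ℝ) (s : Fin n) :
    fderiv ℝ (fun u : Fin n → ℝ => (1 / 2) * ∑ p, ∑ q, S p q * u p * u q) u (Pi.single s 1) =
      ∑ q, S s q * u q := by
  have hproj (p : Fin n) : HasFDerivAt (fun u : Fin n → ℝ => u p)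
      (ContinuousLinearMap.proj (R := ℝ) (φ := fun _ : Fin n => ℝ) p) u := hasFDerivAt_apply p u
  have hder := (HasFDerivAt.fun_sum (u := Finset.univ) fun p _ =>
    HasFDerivAt.fun_sum (u := Finset.univ) fun q _ =>
      ((hproj p).const_mul (S p q)).fun_mul (hproj q)).const_mul (1 / 2 : ℝ)
  rw [hder.fderiv]
  simp only [smul_apply, sum_apply,
    add_apply, ContinuousLinearMap.proj_apply, smul_eq_mul,
    Finset.sum_add_distrib, Pi.single_apply, mul_ite, mul_one, mul_zero, Finset.sum_ite_eq',
    Finset.sum_ite_irrel, Finset.sum_const_zero, Finset.mem_univ, if_true]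
  rw [← Finset.sum_add_distrib, Finset.mul_sum]
  refine Finset.sum_congr rfl fun q _ => ?_
  rw [hS q s]
  ring

/-- The Euler–Lagrange derivative of a density quadratic in `b` and affine in `b_x`. -/
theorem ELd_quadratic {n : ℕ} {ζ : Fin n → Fin n → Fin n → ℝ} {W : Fin n → Fin n → ℝ}
    (hζ : ∀ p q m, ζ p q m = ζ q p m) (hW : ∀ p q, W p q = W q p)
    {b : ℝ → Fin n → ℝ} (hb : Differentiable ℝ b) (s : Fin n) (x : ℝ) :
    ELd (fun u v => (1 / 2) * ∑ p, ∑ q, ((∑ m, ζ p q m * v m) - W p q) * u p * u q) b s x =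
      ∑ q, ((∑ m, (ζ s q m - ζ q m s) * deriv b x m) - W s q) * b x q := by
  have hv (y : ℝ) : fderiv ℝ (fun v : Fin n → ℝ =>
        (1 / 2) * ∑ p, ∑ q, ((∑ m, ζ p q m * v m) - W p q) * b y p * b y q)
        (deriv b y) (Pi.single s 1) = (1 / 2) * ∑ p, ∑ q, ζ p q s * b y p * b y q := by
    have hproj (p : Fin n) : HasFDerivAt (fun u : Fin n → ℝ => u p)
        (ContinuousLinearMap.proj (R := ℝ) (φ := fun _ : Fin n => ℝ) p) (deriv b y) :=
      hasFDerivAt_apply p _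
    have hder := (HasFDerivAt.fun_sum (u := Finset.univ) fun p _ =>
      HasFDerivAt.fun_sum (u := Finset.univ) fun q _ =>
        ((((HasFDerivAt.fun_sum (u := Finset.univ) fun m _ =>
          (hproj m).const_mul (ζ p q m)).sub_const (W p q)).mul_const (b y p)).mul_const
            (b y q))).const_mul (1 / 2 : ℝ)
    rw [hder.fderiv]
    simp only [smul_apply, sum_apply,
      ContinuousLinearMap.proj_apply, smul_eq_mul, Pi.single_apply, mul_ite, mul_one, mul_zero,
      Finset.sum_ite_eq', Finset.mem_univ, if_true]
    congr 1
    refine Finset.sum_congr rfl fun p _ => Finset.sum_congr rfl fun q _ => ?_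
    ring
  have hcoord (p : Fin n) : HasDerivAt (fun y => b y p) (deriv b x p) x :=
    hasDerivAt_pi.1 (hb x).hasDerivAt p
  have hdx := ((HasDerivAt.fun_sum (u := Finset.univ) fun p _ =>
    HasDerivAt.fun_sum (u := Finset.univ) fun q _ =>
      ((hcoord p).const_mul (ζ p q s)).fun_mul (hcoord q)).const_mul (1 / 2 : ℝ)).deriv
  have hsym : (1 / 2) * ∑ p, ∑ q,
      (ζ p q s * deriv b x p * b x q + ζ p q s * b x p * deriv b x q) =
        ∑ q, (∑ m, ζ q m s * deriv b x m) * b x q := by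
    have hswap : ∑ p, ∑ q, ζ p q s * deriv b x p * b x q =
        ∑ p, ∑ q, ζ p q s * b x p * deriv b x q := by
      rw [Finset.sum_comm]
      refine Finset.sum_congr rfl fun p _ => Finset.sum_congr rfl fun q _ => ?_
      rw [hζ q p]
      ring
    simp only [Finset.sum_add_distrib, hswap]
    rw [← two_mul, ← mul_assoc, one_div, inv_mul_cancel₀ two_ne_zero, one_mul]
    refine Finset.sum_congr rfl fun p _ => ?_
    rw [Finset.sum_mul]
    refine Finset.sum_congr rfl fun q _ => ?_
    ring
  unfold ELd
  simp only [hv]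
  rw [fderiv_half_quadratic_single (S := fun p q => (∑ m, ζ p q m * deriv b x m) - W p q), hdx,
    hsym, ← Finset.sum_sub_distrib]
  · refine Finset.sum_congr rfl fun q _ => ?_
    simp only [sub_mul, Finset.sum_sub_distrib]
    ring
  · intro p q
    simp only [hζ p q, hW p q]

/-- The Hamiltonian of a non-diagonalizable hydrodynamic type system with respect to
the factorised third-order Hamiltonian operator. -/
theorem hamiltonian_of_hydrodynamic_system
    (n : ℕ) (hn : 1 ≤ n)
    (ψ : Fin n → Fin n → Fin n → ℝ)   -- ψ^γ_{km} = ψ γ k m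
    (ω : Fin n → Fin n → ℝ)           -- ω^γ_k = ω γ k
    (hskew : ∀ γ k m, ψ γ k m = - ψ γ m k)
    (Φ : Matrix (Fin n) (Fin n) ℝ)
    (hΦsym : ∀ β γ, Φ β γ = Φ γ β)
    (hΦunit : IsUnit Φ)
    (hconstr1 : ∀ i j k s, ∑ β, ∑ γ,
      Φ β γ * (ψ β i s * ψ γ j k + ψ β j s * ψ γ k i + ψ β k s * ψ γ i j) = 0)
    (hconstr2 : ∀ i j k, ∑ β, ∑ γ,
      Φ β γ * (ω β i * ψ γ j k + ω β j * ψ γ k i + ω β k * ψ γ i j) = 0)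
    (η : Fin n → Fin n → ℝ)           -- η^γ_m = η γ m
    (hη1 : ∀ q p k, ∑ β, ∑ γ,
      Φ β γ * (ψ β q p * η γ k + ψ β k q * η γ p + ψ β p k * η γ q) = 0)
    (hη2 : ∀ p q, ∑ β, ∑ γ, Φ β γ * (ω β p * η γ q - ω β q * η γ p) = 0)
    (Ψ : (Fin n → ℝ) → Matrix (Fin n) (Fin n) ℝ)  -- row k, column γ: ψ^γ_k(a)
    (hΨ : ∀ a k γ, Ψ a k γ = (∑ m, ψ γ k m * a m) + ω γ k)
    (ζ : Fin n → Fin n → Fin n → ℝ)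
    (hζ : ∀ k p q, ζ k p q = (1/3) * ∑ β, ∑ γ,
      Φ β γ * (ψ β k p * η γ q + 2 * ψ β q k * η γ p))
    (h : (Fin n → ℝ) → (Fin n → ℝ) → ℝ)
    (hh : ∀ b bx, h b bx = (1/2) * ∑ p, ∑ q,
      ((∑ m, ζ p q m * bx m) - ∑ β, ∑ γ, Φ β γ * ω β p * η γ q) * b p * b q) :
    -- ζ is symmetric in its first two indices
    (∀ k p q, ζ k p q = ζ p k q)
    ∧
    -- the system b_t^i = v^i(b_x) with v^i(a) = ψ^i_γ(a) η^γ_m a^m is Hamiltonian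
    (∀ b : ℝ → Fin n → ℝ, ContDiff ℝ (⊤ : ℕ∞) b → (∀ x, IsUnit (Ψ (deriv b x))) →
      ∀ i x, -(∑ β, ∑ γ, ∑ s, Φ⁻¹ β γ * (Ψ (deriv b x))⁻¹ β i *
          deriv (fun y => (Ψ (deriv b y))⁻¹ γ s * ELd h b s y) x)
        = ∑ γ, (Ψ (deriv b x))⁻¹ γ i * (∑ m, η γ m * deriv b x m)) := by
  let T : Fin n → Fin n → Fin n → ℝ := fun p q k => ∑ β, ∑ γ, Φ β γ * (ψ β p q * η γ k)
  let W : Fin n → Fin n → ℝ := fun p q => ∑ β, ∑ γ, Φ β γ * ω β p * η γ q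
  have hTskew (p q k) : T p q k = -T q p k := by
    simp only [T, ← Finset.sum_neg_distrib]
    refine Finset.sum_congr rfl fun β _ => Finset.sum_congr rfl fun γ _ => ?_
    rw [hskew β p q]
    ring
  have hTcyc (q p k) : T q p k + T k q p + T p k q = 0 := by
    simpa only [T, mul_add, Finset.sum_add_distrib] using hη1 q p k
  have hζT (k p q) : ζ k p q = 1 / 3 * (T k p q + 2 * T q k p) := by
    rw [hζ]
    simp only [T, mul_add, Finset.sum_add_distrib, Finset.mul_sum]
    congr 1
    refine Finset.sum_congr rfl fun β _ => Finset.sum_congr rfl fun γ _ => ?_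
    ring
  have hWsym (p q) : W p q = W q p := by
    have hpq := hη2 p q
    simp only [mul_sub, Finset.sum_sub_distrib, ← mul_assoc] at hpq
    exact sub_eq_zero.1 hpq
  have hζsym (k p q) : ζ k p q = ζ p k q := by
    rw [hζT, hζT]
    linarith [hTcyc k p q, hTskew p k q, hTskew q p k]
  have hζdiff (s q m) : ζ s q m - ζ q m s = -T s m q := by
    rw [hζT, hζT]
    linarith [hTcyc s q m, hTskew s m q]
  refine ⟨hζsym, fun b hb hunit i x => ?_⟩
  have hb1 : Differentiable ℝ b := hb.differentiable (by simp)
  have hb2 : Differentiable ℝ (deriv b) :=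
    ((contDiff_infty_iff_deriv (𝕜 := ℝ)).1 hb).2.differentiable (by simp)
  let c : ℝ → Fin n → ℝ := fun y β => ∑ γ, Φ β γ * ∑ q, η γ q * b y q
  have hE (s y) : ELd h b s y = -∑ β, Ψ (deriv b y) s β * c y β := by
    have hhW : h = fun u v =>
        (1 / 2) * ∑ p, ∑ q, ((∑ m, ζ p q m * v m) - W p q) * u p * u q := by
      funext u v
      exact hh u v
    rw [hhW, ELd_quadratic hζsym hWsym hb1]
    have hcoef (q) : (∑ m, (ζ s q m - ζ q m s) * deriv b y m) - W s q =
        -∑ β, Ψ (deriv b y) s β * ∑ γ, Φ β γ * η γ q := by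
      simp only [hζdiff, hΨ, add_mul, Finset.sum_add_distrib, neg_mul, Finset.sum_neg_distrib,
        neg_add, sub_eq_add_neg]
      congr 2
      · simp only [T, Finset.sum_mul, Finset.mul_sum]
        rw [Finset.sum_comm]
        refine Finset.sum_congr rfl fun β _ => ?_
        rw [Finset.sum_comm]
        refine Finset.sum_congr rfl fun γ _ => Finset.sum_congr rfl fun m _ => ?_
        ring
      · simp only [W, Finset.mul_sum]
        refine Finset.sum_congr rfl fun β _ => Finset.sum_congr rfl fun γ _ => ?_
        ring
    simp only [hcoef, c, neg_mul, Finset.sum_neg_distrib, Finset.sum_mul, Finset.mul_sum]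
    congr 1
    rw [Finset.sum_comm]
    refine Finset.sum_congr rfl fun β _ => ?_
    rw [Finset.sum_comm]
    refine Finset.sum_congr rfl fun γ _ => Finset.sum_congr rfl fun q _ => ?_
    ring
  have hcoord (p : Fin n) (y : ℝ) : HasDerivAt (fun y => b y p) (deriv b y p) y :=
    hasDerivAt_pi.1 (hb1 y).hasDerivAt p
  have hc (β) (y : ℝ) :
      HasDerivAt (fun y => c y β) (∑ γ, Φ β γ * ∑ q, η γ q * deriv b y q) y :=
    HasDerivAt.fun_sum fun γ _ => (HasDerivAt.fun_sum fun q _ =>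
      (hcoord q y).const_mul (η γ q)).const_mul (Φ β γ)
  have hΨdiff (k γ) : DifferentiableAt ℝ (fun y => Ψ (deriv b y) k γ) x := by
    simp only [hΨ]
    refine (DifferentiableAt.fun_sum fun m _ => ?_).add_const _
    exact (differentiableAt_pi.1 (hb2 x) m).const_mul _
  have hEdiff (s) : DifferentiableAt ℝ (fun y => ELd h b s y) x := by
    simp only [hE]
    exact (DifferentiableAt.fun_sum fun β _ =>
      (hΨdiff s β).mul (hc β x).differentiableAt).neg
  have hflux (γ y) : ∑ s, (Ψ (deriv b y))⁻¹ γ s * ELd h b s y = -c y γ := by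
    have hinv : (Ψ (deriv b y))⁻¹ * Ψ (deriv b y) = 1 :=
      Matrix.nonsing_inv_mul _ ((Matrix.isUnit_iff_isUnit_det _).1 (hunit y))
    have hmul := congrFun (congrArg (Matrix.mulVec · (c y)) hinv) γ
    simp only [← Matrix.mulVec_mulVec, Matrix.one_mulVec] at hmul
    simp only [hE, mul_neg, Finset.sum_neg_distrib]
    exact congrArg Neg.neg hmul
  have hderiv (γ) : ∑ s, deriv (fun y => (Ψ (deriv b y))⁻¹ γ s * ELd h b s y) x =
      -∑ δ, Φ γ δ * ∑ q, η δ q * deriv b x q := by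
    rw [← deriv_fun_sum fun s _ =>
      (differentiableAt_matrix_inv_apply hΨdiff (hunit x) γ s).fun_mul (hEdiff s)]
    simp only [hflux]
    exact (hc γ x).fun_neg.deriv
  have hΦinv (β) : ∑ γ, Φ⁻¹ β γ * ∑ δ, Φ γ δ * ∑ q, η δ q * deriv b x q =
      ∑ q, η β q * deriv b x q := by
    have hinv : Φ⁻¹ * Φ = 1 :=
      Matrix.nonsing_inv_mul _ ((Matrix.isUnit_iff_isUnit_det _).1 hΦunit)
    have hmul := congrFun
      (congrArg (Matrix.mulVec · fun δ => ∑ q, η δ q * deriv b x q) hinv) β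
    simp only [← Matrix.mulVec_mulVec, Matrix.one_mulVec] at hmul
    exact hmul
  simp only [← Finset.mul_sum, hderiv, mul_neg, Finset.sum_neg_distrib, neg_neg]
  refine Finset.sum_congr rfl fun β _ => ?_
  rw [← hΦinv β, Finset.mul_sum]
  refine Finset.sum_congr rfl fun γ _ => ?_
  ring
end

section
/- For each k in a finite index set, let h_{1k} = −½ G_{ksm}(u) u_x^s u_x^m and h_{3k} = Q^{(1)}_{kms}(u) u_{xx}^m u_{xx}^s + Q^{(2)}_{klms}(u) u_{xx}^l u_x^m u_x^s + Q^{(3)}_{klsmp}(u) u_x^l u_x^s u_x^m u_x^p be densities with smooth coefficient functions on ℝⁿ, with G_{ksm} = G_{kms} and Q^{(1)}_{kms} = Q^{(1)}_{ksm}. Suppose the bi-Hamiltonian recursion holds: for each k, for every smooth curve u: ℝ → ℝⁿ and every x, K^{ij} (d/dx)(δH_{3k}/δu^j)(x) = (Â₂ (δH_{1k}/δu))^i(x) for all i. Let ξ^k be real constants. Then at every point u₀ ∈ ℝⁿ at which the matrix (ξ^m G_{mpq}(u₀))_{p,q} is invertible, with inverse entries C^{qj}(u₀), the leading coefficient of Â₂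 is uniquely determined by g^{ij}(u₀) = 2 ξ^m K^{ip} Q^{(1)}_{mpq}(u₀) C^{qj}(u₀). -/
open scoped BigOperators

/-- Variational (Euler–Lagrange) derivative of a second-order density `h(u, u_x, u_xx)`
along a smooth curve `u`. -/
noncomputable def VarDer2 {n : ℕ}
    (h : (Fin n → ℝ) → (Fin n → ℝ) → (Fin n → ℝ) → ℝ)
    (u : ℝ → Fin n → ℝ) (j : Fin n) (x : ℝ) : ℝ :=
  fderiv ℝ (fun a => h a (deriv u x) (deriv (deriv u) x)) (u x) (Pi.single j 1)
  - deriv (fun y => fderiv ℝ (fun a => h (u y) a (deriv (deriv u) y)) (deriv u y)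
      (Pi.single j 1)) x
  + deriv (deriv (fun y => fderiv ℝ (fun a => h (u y) (deriv u y) a)
      (deriv (deriv u) y) (Pi.single j 1))) x

/-- Action of a third-order Dubrovin–Novikov type operator Â₂ on a covector field `p`
along a curve `u`. -/
noncomputable def A2apply {n : ℕ}
    (g : Fin n → Fin n → (Fin n → ℝ) → ℝ)
    (bc : Fin n → Fin n → Fin n → (Fin n → ℝ) → ℝ)
    (cc : Fin n → Fin n → Fin n → (Fin n → ℝ) → ℝ)
    (cc2 : Fin n → Fin n → Fin n → Fin n → (Fin n → ℝ) → ℝ)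
    (dc : Fin n → Fin n → Fin n → (Fin n → ℝ) → ℝ)
    (dc2 : Fin n → Fin n → Fin n → Fin n → (Fin n → ℝ) → ℝ)
    (dc3 : Fin n → Fin n → Fin n → Fin n → Fin n → (Fin n → ℝ) → ℝ)
    (u : ℝ → Fin n → ℝ) (p : Fin n → ℝ → ℝ) (i : Fin n) (x : ℝ) : ℝ :=
  (∑ j, g i j (u x) * deriv (deriv (deriv (p j))) x)
  + (∑ j, ∑ k, bc i j k (u x) * deriv u x k * deriv (deriv (p j)) x)
  + (∑ j, ((∑ k, cc i j k (u x) * deriv (deriv u) x k)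
      + ∑ k, ∑ m, cc2 i j k m (u x) * deriv u x k * deriv u x m) * deriv (p j) x)
  + (∑ j, ((∑ k, dc i j k (u x) * deriv (deriv (deriv u)) x k)
      + (∑ k, ∑ m, dc2 i j k m (u x) * deriv (deriv u) x k * deriv u x m)
      + (∑ k, ∑ m, ∑ q, dc3 i j k m q (u x) * deriv u x k * deriv u x m * deriv u x q))
        * p j x)

/-- `f` is `x ^ k` times a smooth function whose value at the origin is `c`. -/
def HasLeadingCoeff (f : ℝ → ℝ) (k : ℕ) (c : ℝ) : Prop :=
  ∃ A : ℝ → ℝ, ContDiff ℝ (⊤ : ℕ∞) A ∧ A 0 = c ∧ ∀ x, f x = x ^ k * A x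

namespace HasLeadingCoeff

variable {f g : ℝ → ℝ} {k : ℕ} {c d : ℝ}

theorem add (hf : HasLeadingCoeff f k c) (hg : HasLeadingCoeff g k d) :
    HasLeadingCoeff (fun x => f x + g x) k (c + d) := by
  obtain ⟨A, hA, hA0, hfA⟩ := hf
  obtain ⟨B, hB, hB0, hgB⟩ := hg
  exact ⟨fun x => A x + B x, hA.add hB, by simp [hA0, hB0],
    fun x => by simp only [hfA, hgB]; ring⟩

theorem sub (hf : HasLeadingCoeff f k c) (hg : HasLeadingCoeff g k d) :
    HasLeadingCoeff (fun x => f x - g x) k (c - d) := by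
  obtain ⟨A, hA, hA0, hfA⟩ := hf
  obtain ⟨B, hB, hB0, hgB⟩ := hg
  exact ⟨fun x => A x - B x, hA.sub hB, by simp [hA0, hB0],
    fun x => by simp only [hfA, hgB]; ring⟩

theorem lower {l : ℕ} (hf : HasLeadingCoeff f l c) (h : k < l) : HasLeadingCoeff f k 0 := by
  obtain ⟨A, hA, hA0, hfA⟩ := hf
  refine ⟨fun x => x ^ (l - k) * A x, by fun_prop, by simp [Nat.sub_ne_zero_of_lt h], fun x => ?_⟩
  rw [hfA, ← mul_assoc, ← pow_add, Nat.add_sub_cancel' h.le]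

theorem deriv (hf : HasLeadingCoeff f (k + 1) c) :
    HasLeadingCoeff (deriv f) k ((k + 1) * c) := by
  obtain ⟨A, hA, hA0, hfA⟩ := hf
  obtain rfl : f = fun x => x ^ (k + 1) * A x := funext hfA
  have hA' : ContDiff ℝ (⊤ : ℕ∞) (_root_.deriv A) := (contDiff_infty_iff_deriv.1 hA).2
  refine ⟨fun x => (k + 1) * A x + x * _root_.deriv A x, by fun_prop, by simp [hA0], fun x => ?_⟩
  have h1 : HasDerivAt A (_root_.deriv A x) x :=
    ((contDiff_infty_iff_deriv.1 hA).1 x).hasDerivAt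
  beta_reduce
  rw [((hasDerivAt_pow (k + 1) x).fun_mul h1).deriv]
  simp only [Nat.add_sub_cancel]
  push_cast
  ring

theorem apply_zero (hf : HasLeadingCoeff f 0 c) : f 0 = c := by
  obtain ⟨A, -, hA0, hfA⟩ := hf
  simp [hfA, hA0]

end HasLeadingCoeff

/-- The curve `x ↦ a + x ^ 5 v`. -/
def quinticCurve {n : ℕ} (a v : Fin n → ℝ) (x : ℝ) : Fin n → ℝ := fun i => a i + x ^ 5 * v i

section QuinticCurve

variable {n : ℕ} (a v : Fin n → ℝ)

theorem contDiff_quinticCurve : ContDiff ℝ (⊤ : ℕ∞) (quinticCurve a v) := by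
  unfold quinticCurve
  fun_prop

theorem quinticCurve_zero : quinticCurve a v 0 = a := by
  ext i
  simp [quinticCurve]

theorem deriv_quinticCurve : deriv (quinticCurve a v) = fun x i => 5 * x ^ 4 * v i := by
  ext x i
  have h : HasDerivAt (quinticCurve a v) (fun i => 5 * x ^ 4 * v i) x := by
    refine hasDerivAt_pi.2 fun i => ?_
    simpa [quinticCurve] using ((hasDerivAt_pow 5 x).mul_const (v i)).const_add (a i)
  rw [h.deriv]

theorem deriv_deriv_quinticCurve :
    deriv (deriv (quinticCurve a v)) = fun x i => 20 * x ^ 3 * v i := by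
  rw [deriv_quinticCurve]
  ext x i
  have h : HasDerivAt (fun x i => 5 * x ^ 4 * v i) (fun i => 20 * x ^ 3 * v i) x := by
    refine hasDerivAt_pi.2 fun i => ?_
    refine (((hasDerivAt_pow 4 x).const_mul 5).mul_const (v i)).congr_deriv ?_
    push_cast
    ring
  rw [h.deriv]

theorem deriv_deriv_deriv_quinticCurve_zero :
    deriv (deriv (deriv (quinticCurve a v))) 0 = 0 := by
  rw [deriv_deriv_quinticCurve]
  have h : HasDerivAt (fun x i => 20 * x ^ 3 * v i) (0 : Fin n → ℝ) (0 : ℝ) := by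
    refine hasDerivAt_pi.2 fun i => ?_
    exact (((hasDerivAt_pow 3 (0 : ℝ)).const_mul 20).mul_const (v i)).congr_deriv (by simp)
  rw [h.deriv]

theorem contDiff_fderiv_quinticCurve {φ : (Fin n → ℝ) → ℝ} (hφ : ContDiff ℝ (⊤ : ℕ∞) φ)
    (w : Fin n → ℝ) : ContDiff ℝ (⊤ : ℕ∞) fun x => fderiv ℝ φ (quinticCurve a v x) w :=
  ((hφ.fderiv_right (m := (⊤ : ℕ∞)) (by simp)).comp (contDiff_quinticCurve a v)).clm_apply
    contDiff_const

end QuinticCurve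

section PolynomialDerivatives

variable {n : ℕ}

theorem fderiv_quadratic_apply (c : Fin n → Fin n → ℝ) (a w : Fin n → ℝ) :
    fderiv ℝ (fun a : Fin n → ℝ => ∑ m, ∑ s, c m s * a m * a s) a w
      = ∑ m, ∑ s, c m s * (w m * a s + a m * w s) := by
  have hp : ∀ i, HasFDerivAt (fun a : Fin n → ℝ => a i)
      (ContinuousLinearMap.proj (R := ℝ) (φ := fun _ : Fin n => ℝ) i) a :=
    fun i => hasFDerivAt_apply i a
  rw [(HasFDerivAt.fun_sum fun m _ => HasFDerivAt.fun_sum fun s _ =>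
    ((hp m).const_mul (c m s)).fun_mul (hp s)).fderiv]
  simp only [_root_.sum_apply]
  refine Finset.sum_congr rfl fun m _ => Finset.sum_congr rfl fun s _ => ?_
  simp
  ring

theorem fderiv_quartic_apply (c : Fin n → Fin n → Fin n → Fin n → ℝ) (a w : Fin n → ℝ) :
    fderiv ℝ (fun a : Fin n → ℝ => ∑ l, ∑ s, ∑ m, ∑ p, c l s m p * a l * a s * a m * a p) a w
      = ∑ l, ∑ s, ∑ m, ∑ p, c l s m p *
        (w l * a s * a m * a p + a l * w s * a m * a p + a l * a s * w m * a p
          + a l * a s * a m * w p) := by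
  have hp : ∀ i, HasFDerivAt (fun a : Fin n → ℝ => a i)
      (ContinuousLinearMap.proj (R := ℝ) (φ := fun _ : Fin n => ℝ) i) a :=
    fun i => hasFDerivAt_apply i a
  rw [(HasFDerivAt.fun_sum fun l _ => HasFDerivAt.fun_sum fun s _ => HasFDerivAt.fun_sum fun m _ =>
    HasFDerivAt.fun_sum fun p _ =>
    ((((hp l).const_mul (c l s m p)).fun_mul (hp s)).fun_mul (hp m)).fun_mul (hp p)).fderiv]
  simp only [_root_.sum_apply]
  refine Finset.sum_congr rfl fun l _ => Finset.sum_congr rfl fun s _ =>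
    Finset.sum_congr rfl fun m _ => Finset.sum_congr rfl fun p _ => ?_
  simp
  ring

theorem fderiv_linear_apply (c : Fin n → ℝ) (a w : Fin n → ℝ) :
    fderiv ℝ (fun a : Fin n → ℝ => ∑ l, c l * a l) a w = ∑ l, c l * w l := by
  have hp : ∀ i, HasFDerivAt (fun a : Fin n → ℝ => a i)
      (ContinuousLinearMap.proj (R := ℝ) (φ := fun _ : Fin n => ℝ) i) a :=
    fun i => hasFDerivAt_apply i a
  rw [(HasFDerivAt.fun_sum fun l _ => (hp l).const_mul (c l)).fderiv]
  simp

end PolynomialDerivatives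

section Densities

variable {n : ℕ}

theorem hasLeadingCoeff_varDer2_firstOrder (G : Fin n → Fin n → (Fin n → ℝ) → ℝ)
    (hG : ∀ s m, ContDiff ℝ (⊤ : ℕ∞) (G s m)) (hGsym : ∀ s m u, G s m u = G m s u)
    (a v : Fin n → ℝ) (j : Fin n) :
    HasLeadingCoeff
      (fun x => VarDer2 (fun u ux _ => -(1/2) * ∑ s, ∑ m, G s m u * ux s * ux m)
        (quinticCurve a v) j x) 3 (20 * ∑ m, G j m a * v m) := by
  set w : Fin n → ℝ := Pi.single j 1 with hw
  have hu := contDiff_quinticCurve a v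
  have hU : HasLeadingCoeff (fun x => fderiv ℝ (fun b => -(1/2) * ∑ s, ∑ m, G s m b
      * (deriv (quinticCurve a v) x s) * (deriv (quinticCurve a v) x m)) (quinticCurve a v x) w)
      8 (-(25/2) * fderiv ℝ (fun b => ∑ s, ∑ m, G s m b * v s * v m) a w) := by
    refine ⟨fun x => -(25/2) * fderiv ℝ (fun b => ∑ s, ∑ m, G s m b * v s * v m)
      (quinticCurve a v x) w, contDiff_const.mul (contDiff_fderiv_quinticCurve a v
        (by fun_prop) w), by simp [quinticCurve_zero], fun x => ?_⟩
    have hφ : Differentiable ℝ (fun b => ∑ s, ∑ m, G s m b * v s * v m) :=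
      ContDiff.differentiable (n := (⊤ : ℕ∞)) (by fun_prop) (by simp)
    have e : (fun b => -(1/2) * ∑ s, ∑ m, G s m b
        * (deriv (quinticCurve a v) x s) * (deriv (quinticCurve a v) x m))
        = fun b => (x ^ 8 * -(25/2)) * ∑ s, ∑ m, G s m b * v s * v m := by
      ext b
      simp only [deriv_quinticCurve, Finset.mul_sum]
      refine Finset.sum_congr rfl fun s _ => Finset.sum_congr rfl fun m _ => ?_
      ring
    beta_reduce
    rw [e, fderiv_const_mul (hφ _)]
    simp [mul_assoc]
  have hX : HasLeadingCoeff (fun x => fderiv ℝ (fun b => -(1/2) * ∑ s, ∑ m,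
      G s m (quinticCurve a v x) * b s * b m) (deriv (quinticCurve a v) x) w)
      4 (-5 * ∑ m, G j m a * v m) := by
    refine ⟨fun x => -(5/2) * ∑ s, ∑ m, G s m (quinticCurve a v x) * (w s * v m + v s * w m),
      by fun_prop, ?_, fun x => ?_⟩
    · have h1 : ∑ s, ∑ m, G s m a * (w s * v m) = ∑ m, G j m a * v m := by
        rw [Finset.sum_eq_single j (by intro b _ hb; simp [hw, hb]) (by simp)]
        simp [hw]
      have h2 : ∑ s, ∑ m, G s m a * (v s * w m) = ∑ m, G j m a * v m := by
        refine Finset.sum_congr rfl fun s _ => ?_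
        rw [Finset.sum_eq_single j (by intro b _ hb; simp [hw, hb]) (by simp), hGsym]
        simp [hw]
      simp only [quinticCurve_zero, mul_add, Finset.sum_add_distrib, h1, h2]
      ring
    · have hd : DifferentiableAt ℝ (fun b : Fin n → ℝ => ∑ s, ∑ m,
          G s m (quinticCurve a v x) * b s * b m) (deriv (quinticCurve a v) x) := by fun_prop
      beta_reduce
      rw [fderiv_const_mul hd, _root_.smul_apply, fderiv_quadratic_apply]
      simp only [deriv_quinticCurve, Finset.mul_sum, smul_eq_mul]
      refine Finset.sum_congr rfl fun s _ => Finset.sum_congr rfl fun m _ => ?_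
      ring
  have h := (hU.lower (k := 3) (by norm_num)).sub hX.deriv
  simp only [VarDer2]
  convert h using 1
  · ext x
    simp [hw]
  · push_cast
    ring

theorem hasLeadingCoeff_varDer2_secondOrder (Q1 : Fin n → Fin n → (Fin n → ℝ) → ℝ)
    (hQ1 : ∀ m s, ContDiff ℝ (⊤ : ℕ∞) (Q1 m s)) (hQ1sym : ∀ m s u, Q1 m s u = Q1 s m u)
    (Q2 : Fin n → Fin n → Fin n → (Fin n → ℝ) → ℝ)
    (hQ2 : ∀ l m s, ContDiff ℝ (⊤ : ℕ∞) (Q2 l m s))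
    (Q3 : Fin n → Fin n → Fin n → Fin n → (Fin n → ℝ) → ℝ)
    (hQ3 : ∀ l s m p, ContDiff ℝ (⊤ : ℕ∞) (Q3 l s m p))
    (a v : Fin n → ℝ) (j : Fin n) :
    HasLeadingCoeff
      (fun x => VarDer2 (fun u ux uxx => (∑ m, ∑ s, Q1 m s u * uxx m * uxx s)
        + (∑ l, ∑ m, ∑ s, Q2 l m s u * uxx l * ux m * ux s)
        + (∑ l, ∑ s, ∑ m, ∑ p, Q3 l s m p u * ux l * ux s * ux m * ux p))
        (quinticCurve a v) j x) 1 (240 * ∑ m, Q1 j m a * v m) := by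
  set w : Fin n → ℝ := Pi.single j 1 with hw
  have hu := contDiff_quinticCurve a v
  have hU : ∃ c, HasLeadingCoeff (fun x => fderiv ℝ (fun b =>
      (∑ m, ∑ s, Q1 m s b * deriv (deriv (quinticCurve a v)) x m
        * deriv (deriv (quinticCurve a v)) x s)
      + (∑ l, ∑ m, ∑ s, Q2 l m s b * deriv (deriv (quinticCurve a v)) x l
        * deriv (quinticCurve a v) x m * deriv (quinticCurve a v) x s)
      + (∑ l, ∑ s, ∑ m, ∑ p, Q3 l s m p b * deriv (quinticCurve a v) x l
        * deriv (quinticCurve a v) x s * deriv (quinticCurve a v) x m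
        * deriv (quinticCurve a v) x p)) (quinticCurve a v x) w) 6 c := by
    have h1 : ContDiff ℝ (⊤ : ℕ∞) (fun b => ∑ m, ∑ s, Q1 m s b * v m * v s) := by fun_prop
    have h2 : ContDiff ℝ (⊤ : ℕ∞) (fun b => ∑ l, ∑ m, ∑ s, Q2 l m s b * v l * v m * v s) := by
      fun_prop
    have h3 : ContDiff ℝ (⊤ : ℕ∞)
        (fun b => ∑ l, ∑ s, ∑ m, ∑ p, Q3 l s m p b * v l * v s * v m * v p) := by
      fun_prop
    have d1 := contDiff_fderiv_quinticCurve a v h1 w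
    have d2 := contDiff_fderiv_quinticCurve a v h2 w
    have d3 := contDiff_fderiv_quinticCurve a v h3 w
    have e1 := h1.differentiable (by simp)
    have e2 := h2.differentiable (by simp)
    have e3 := h3.differentiable (by simp)
    refine ⟨_, _, (contDiff_const (c := (400 : ℝ))).mul d1 |>.add
      (((contDiff_id.pow 5).mul (contDiff_const (c := (500 : ℝ)))).mul d2) |>.add
      (((contDiff_id.pow 10).mul (contDiff_const (c := (625 : ℝ)))).mul d3), rfl, fun x => ?_⟩
    have e : (fun b =>
        (∑ m, ∑ s, Q1 m s b * deriv (deriv (quinticCurve a v)) x m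
          * deriv (deriv (quinticCurve a v)) x s)
        + (∑ l, ∑ m, ∑ s, Q2 l m s b * deriv (deriv (quinticCurve a v)) x l
          * deriv (quinticCurve a v) x m * deriv (quinticCurve a v) x s)
        + (∑ l, ∑ s, ∑ m, ∑ p, Q3 l s m p b * deriv (quinticCurve a v) x l
          * deriv (quinticCurve a v) x s * deriv (quinticCurve a v) x m
          * deriv (quinticCurve a v) x p))
        = fun b => (400 * x ^ 6) * (∑ m, ∑ s, Q1 m s b * v m * v s)
          + (500 * x ^ 11) * (∑ l, ∑ m, ∑ s, Q2 l m s b * v l * v m * v s)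
          + (625 * x ^ 16) * (∑ l, ∑ s, ∑ m, ∑ p, Q3 l s m p b * v l * v s * v m * v p) := by
      ext b
      simp only [deriv_deriv_quinticCurve]
      simp only [deriv_quinticCurve, Finset.mul_sum]
      congr 1
      · congr 1
        · refine Finset.sum_congr rfl fun s _ => Finset.sum_congr rfl fun m _ => ?_
          ring
        · refine Finset.sum_congr rfl fun s _ => Finset.sum_congr rfl fun m _ =>
            Finset.sum_congr rfl fun l _ => ?_
          ring
      · refine Finset.sum_congr rfl fun s _ => Finset.sum_congr rfl fun m _ =>
          Finset.sum_congr rfl fun l _ => Finset.sum_congr rfl fun p _ => ?_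
        ring
    beta_reduce
    rw [e, ((((e1 _).hasFDerivAt.const_mul _).fun_add ((e2 _).hasFDerivAt.const_mul _)).fun_add
      ((e3 _).hasFDerivAt.const_mul _)).fderiv]
    simp only [_root_.add_apply, _root_.smul_apply, smul_eq_mul, id]
    ring
  have hX : ∃ c, HasLeadingCoeff (fun x => fderiv ℝ (fun b =>
      (∑ m, ∑ s, Q1 m s (quinticCurve a v x) * deriv (deriv (quinticCurve a v)) x m
        * deriv (deriv (quinticCurve a v)) x s)
      + (∑ l, ∑ m, ∑ s, Q2 l m s (quinticCurve a v x) * deriv (deriv (quinticCurve a v)) x l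
        * b m * b s)
      + (∑ l, ∑ s, ∑ m, ∑ p, Q3 l s m p (quinticCurve a v x) * b l * b s * b m * b p))
      (deriv (quinticCurve a v) x) w) 7 c := by
    refine ⟨_, fun x => 100 * (∑ m, ∑ s, (∑ l, Q2 l m s (quinticCurve a v x) * v l)
        * (w m * v s + v m * w s))
      + x ^ 5 * (125 * ∑ l, ∑ s, ∑ m, ∑ p, Q3 l s m p (quinticCurve a v x) *
        (w l * v s * v m * v p + v l * w s * v m * v p + v l * v s * w m * v p
          + v l * v s * v m * w p)), by fun_prop, rfl, fun x => ?_⟩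
    have e : (fun b : Fin n → ℝ => ∑ l, ∑ m, ∑ s, Q2 l m s (quinticCurve a v x)
          * deriv (deriv (quinticCurve a v)) x l * b m * b s)
        = fun b => ∑ m, ∑ s, (∑ l, Q2 l m s (quinticCurve a v x)
          * deriv (deriv (quinticCurve a v)) x l) * b m * b s := by
      ext b
      rw [Finset.sum_comm]
      refine Finset.sum_congr rfl fun m _ => ?_
      rw [Finset.sum_comm]
      simp only [Finset.sum_mul]
    beta_reduce
    rw [fderiv_fun_add, fderiv_fun_add,
      e, _root_.add_apply, _root_.add_apply, fderiv_quadratic_apply,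
      fderiv_quartic_apply, deriv_deriv_quinticCurve, deriv_quinticCurve]
    simp only [fderiv_fun_const, Pi.zero_apply, _root_.zero_apply, zero_add,
      mul_add (x ^ 7)]
    simp only [Finset.mul_sum, Finset.sum_mul]
    congr 1
    · refine Finset.sum_congr rfl fun s _ => Finset.sum_congr rfl fun m _ =>
        Finset.sum_congr rfl fun l _ => ?_
      ring
    · refine Finset.sum_congr rfl fun s _ => Finset.sum_congr rfl fun m _ =>
        Finset.sum_congr rfl fun l _ => Finset.sum_congr rfl fun p _ => ?_
      ring
    all_goals fun_prop
  have hXX : HasLeadingCoeff (fun x => fderiv ℝ (fun b =>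
      (∑ m, ∑ s, Q1 m s (quinticCurve a v x) * b m * b s)
      + (∑ l, ∑ m, ∑ s, Q2 l m s (quinticCurve a v x) * b l
        * deriv (quinticCurve a v) x m * deriv (quinticCurve a v) x s)
      + (∑ l, ∑ s, ∑ m, ∑ p, Q3 l s m p (quinticCurve a v x) * deriv (quinticCurve a v) x l
        * deriv (quinticCurve a v) x s * deriv (quinticCurve a v) x m
        * deriv (quinticCurve a v) x p))
      (deriv (deriv (quinticCurve a v)) x) w) 3 (40 * ∑ m, Q1 j m a * v m) := by
    refine ⟨fun x => 20 * (∑ m, ∑ s, Q1 m s (quinticCurve a v x) * (w m * v s + v m * w s))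
      + x ^ 5 * (25 * ∑ l, (∑ m, ∑ s, Q2 l m s (quinticCurve a v x) * v m * v s) * w l),
      by fun_prop, ?_, fun x => ?_⟩
    · have h1 : ∑ s, ∑ m, Q1 s m a * (w s * v m) = ∑ m, Q1 j m a * v m := by
        rw [Finset.sum_eq_single j (by intro b _ hb; simp [hw, hb]) (by simp)]
        simp [hw]
      have h2 : ∑ s, ∑ m, Q1 s m a * (v s * w m) = ∑ m, Q1 j m a * v m := by
        refine Finset.sum_congr rfl fun s _ => ?_
        rw [Finset.sum_eq_single j (by intro b _ hb; simp [hw, hb]) (by simp), hQ1sym]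
        simp [hw]
      simp only [quinticCurve_zero, mul_add, Finset.sum_add_distrib, h1, h2]
      ring
    · have e : (fun b : Fin n → ℝ => ∑ l, ∑ m, ∑ s, Q2 l m s (quinticCurve a v x) * b l
          * deriv (quinticCurve a v) x m * deriv (quinticCurve a v) x s)
          = fun b => ∑ l, (∑ m, ∑ s, Q2 l m s (quinticCurve a v x)
          * deriv (quinticCurve a v) x m * deriv (quinticCurve a v) x s) * b l := by
        ext b
        simp only [Finset.sum_mul]
        refine Finset.sum_congr rfl fun s _ => Finset.sum_congr rfl fun m _ =>
          Finset.sum_congr rfl fun l _ => ?_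
        ring
      beta_reduce
      rw [fderiv_fun_add, fderiv_fun_add,
        e, _root_.add_apply, _root_.add_apply, fderiv_quadratic_apply,
        fderiv_linear_apply, deriv_deriv_quinticCurve, deriv_quinticCurve]
      simp only [fderiv_fun_const, Pi.zero_apply, _root_.zero_apply, add_zero,
        mul_add (x ^ 3)]
      simp only [Finset.mul_sum, Finset.sum_mul]
      congr 1
      · refine Finset.sum_congr rfl fun s _ => Finset.sum_congr rfl fun m _ => ?_
        ring
      · refine Finset.sum_congr rfl fun s _ => Finset.sum_congr rfl fun m _ =>
          Finset.sum_congr rfl fun l _ => ?_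
        ring
      all_goals fun_prop
  obtain ⟨c₁, hU⟩ := hU
  obtain ⟨c₂, hX⟩ := hX
  have h := ((hU.lower (k := 1) (by norm_num)).sub (hX.deriv.lower (k := 1) (by norm_num))).add
    hXX.deriv.deriv
  simp only [VarDer2]
  convert h using 1
  push_cast
  ring

theorem A2apply_quinticCurve_zero
    (g : Fin n → Fin n → (Fin n → ℝ) → ℝ)
    (bc cc : Fin n → Fin n → Fin n → (Fin n → ℝ) → ℝ)
    (cc2 : Fin n → Fin n → Fin n → Fin n → (Fin n → ℝ) → ℝ)
    (dc : Fin n → Fin n → Fin n → (Fin n → ℝ) → ℝ)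
    (dc2 : Fin n → Fin n → Fin n → Fin n → (Fin n → ℝ) → ℝ)
    (dc3 : Fin n → Fin n → Fin n → Fin n → Fin n → (Fin n → ℝ) → ℝ)
    (a v : Fin n → ℝ) (p : Fin n → ℝ → ℝ) (i : Fin n) :
    A2apply g bc cc cc2 dc dc2 dc3 (quinticCurve a v) p i 0
      = ∑ j, g i j a * deriv (deriv (deriv (p j))) 0 := by
  simp only [A2apply, deriv_deriv_deriv_quinticCurve_zero]
  simp only [deriv_deriv_quinticCurve]
  simp [deriv_quinticCurve, quinticCurve_zero]

end Densities

/-- Reconstruction of the leading coefficient of the second (third-order) Hamiltonian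
operator from the bi-Hamiltonian recursion on homogeneous conservation law densities. -/
theorem leading_term_reconstruction
    (n : ℕ) (hn : 1 ≤ n) (N : ℕ)
    (K : Matrix (Fin n) (Fin n) ℝ)
    (hKsym : ∀ i j, K i j = K j i) (hKunit : IsUnit K)
    -- coefficients of the densities h_{1k} and h_{3k}
    (G : Fin N → Fin n → Fin n → (Fin n → ℝ) → ℝ)
    (hGsmooth : ∀ k s m, ContDiff ℝ (⊤ : ℕ∞) (G k s m))
    (hGsym : ∀ k s m u, G k s m u = G k m s u)
    (Q1 : Fin N → Fin n → Fin n → (Fin n → ℝ) → ℝ)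
    (hQ1smooth : ∀ k m s, ContDiff ℝ (⊤ : ℕ∞) (Q1 k m s))
    (hQ1sym : ∀ k m s u, Q1 k m s u = Q1 k s m u)
    (Q2 : Fin N → Fin n → Fin n → Fin n → (Fin n → ℝ) → ℝ)
    (hQ2smooth : ∀ k l m s, ContDiff ℝ (⊤ : ℕ∞) (Q2 k l m s))
    (Q3 : Fin N → Fin n → Fin n → Fin n → Fin n → (Fin n → ℝ) → ℝ)
    (hQ3smooth : ∀ k l s m p, ContDiff ℝ (⊤ : ℕ∞) (Q3 k l s m p))
    -- the densities
    (h1 : Fin N → (Fin n → ℝ) → (Fin n → ℝ) → (Fin n → ℝ) → ℝ)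
    (hh1 : ∀ k u ux uxx, h1 k u ux uxx = -(1/2) * ∑ s, ∑ m, G k s m u * ux s * ux m)
    (h3 : Fin N → (Fin n → ℝ) → (Fin n → ℝ) → (Fin n → ℝ) → ℝ)
    (hh3 : ∀ k u ux uxx, h3 k u ux uxx =
      (∑ m, ∑ s, Q1 k m s u * uxx m * uxx s)
      + (∑ l, ∑ m, ∑ s, Q2 k l m s u * uxx l * ux m * ux s)
      + (∑ l, ∑ s, ∑ m, ∑ p, Q3 k l s m p u * ux l * ux s * ux m * ux p))
    -- coefficients of the third-order operator Â₂, all smooth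
    (g : Fin n → Fin n → (Fin n → ℝ) → ℝ) (hgsm : ∀ i j, ContDiff ℝ (⊤ : ℕ∞) (g i j))
    (bc : Fin n → Fin n → Fin n → (Fin n → ℝ) → ℝ)
    (hbcsm : ∀ i j k, ContDiff ℝ (⊤ : ℕ∞) (bc i j k))
    (cc : Fin n → Fin n → Fin n → (Fin n → ℝ) → ℝ)
    (hccsm : ∀ i j k, ContDiff ℝ (⊤ : ℕ∞) (cc i j k))
    (cc2 : Fin n → Fin n → Fin n → Fin n → (Fin n → ℝ) → ℝ)
    (hcc2sm : ∀ i j k m, ContDiff ℝ (⊤ : ℕ∞) (cc2 i j k m))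
    (dc : Fin n → Fin n → Fin n → (Fin n → ℝ) → ℝ)
    (hdcsm : ∀ i j k, ContDiff ℝ (⊤ : ℕ∞) (dc i j k))
    (dc2 : Fin n → Fin n → Fin n → Fin n → (Fin n → ℝ) → ℝ)
    (hdc2sm : ∀ i j k m, ContDiff ℝ (⊤ : ℕ∞) (dc2 i j k m))
    (dc3 : Fin n → Fin n → Fin n → Fin n → Fin n → (Fin n → ℝ) → ℝ)
    (hdc3sm : ∀ i j k m p, ContDiff ℝ (⊤ : ℕ∞) (dc3 i j k m p))
    -- the bi-Hamiltonian recursion  K ∂_x (δH_{3k}/δu) = Â₂ (δH_{1k}/δu)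
    (hrec : ∀ k : Fin N, ∀ u : ℝ → Fin n → ℝ, ContDiff ℝ (⊤ : ℕ∞) u → ∀ i x,
      (∑ j, K i j * deriv (fun y => VarDer2 (h3 k) u j y) x)
        = A2apply g bc cc cc2 dc dc2 dc3 u (fun j y => VarDer2 (h1 k) u j y) i x)
    (ξ : Fin N → ℝ) :
    ∀ u₀ : Fin n → ℝ,
      IsUnit (Matrix.of (fun p q => ∑ m, ξ m * G m p q u₀)) →
      ∀ i j, g i j u₀ = 2 * ∑ m, ∑ p, ∑ q, ξ m * K i p * Q1 m p q u₀ *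
        (Matrix.of (fun p' q' => ∑ m', ξ m' * G m' p' q' u₀))⁻¹ q j := by
  intro u₀ hunit i j
  have key : ∀ k q, ∑ p, g i p u₀ * G k p q u₀ = 2 * ∑ p, K i p * Q1 k p q u₀ := by
    intro k q
    set v : Fin n → ℝ := Pi.single q 1 with hv
    have e1 : h1 k = fun u ux _ => -(1/2) * ∑ s, ∑ m, G k s m u * ux s * ux m := by
      funext u ux uxx
      exact hh1 k u ux uxx
    have e3 : h3 k = fun u ux uxx => (∑ m, ∑ s, Q1 k m s u * uxx m * uxx s)
        + (∑ l, ∑ m, ∑ s, Q2 k l m s u * uxx l * ux m * ux s)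
        + (∑ l, ∑ s, ∑ m, ∑ p, Q3 k l s m p u * ux l * ux s * ux m * ux p) := by
      funext u ux uxx
      exact hh3 k u ux uxx
    have h := hrec k (quinticCurve u₀ v) (contDiff_quinticCurve u₀ v) i 0
    rw [A2apply_quinticCurve_zero, e1, e3] at h
    have hl := fun p => (hasLeadingCoeff_varDer2_secondOrder (Q1 k) (hQ1smooth k) (hQ1sym k)
      (Q2 k) (hQ2smooth k) (Q3 k) (hQ3smooth k) u₀ v p).deriv.apply_zero
    have hr := fun p => (hasLeadingCoeff_varDer2_firstOrder (G k) (hGsmooth k) (hGsym k)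
      u₀ v p).deriv.deriv.deriv.apply_zero
    simp only [hl, hr] at h
    have hvG : ∀ p, ∑ m, G k p m u₀ * v m = G k p q u₀ := fun p => by simp [hv, Pi.single_apply]
    have hvQ : ∀ p, ∑ m, Q1 k p m u₀ * v m = Q1 k p q u₀ := fun p => by simp [hv, Pi.single_apply]
    simp only [hvG, hvQ] at h
    have h' : 240 * ∑ p, K i p * Q1 k p q u₀ = 120 * ∑ p, g i p u₀ * G k p q u₀ := by
      rw [Finset.mul_sum, Finset.mul_sum]
      convert h using 2
      · push_cast
        ring
      · push_cast
        ring
    linarith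
  set M : Matrix (Fin n) (Fin n) ℝ := Matrix.of (fun p q => ∑ m, ξ m * G m p q u₀) with hM
  have hMdet : IsUnit M.det := (Matrix.isUnit_iff_isUnit_det M).1 hunit
  have hgM : Matrix.of (fun i j => g i j u₀) = Matrix.of (fun i j => g i j u₀) * M * M⁻¹ := by
    rw [Matrix.mul_assoc, Matrix.mul_nonsing_inv M hMdet, Matrix.mul_one]
  have hrow : ∀ q, (Matrix.of (fun i j => g i j u₀) * M) i q
      = 2 * ∑ m, ∑ p, ξ m * K i p * Q1 m p q u₀ := by
    intro q
    simp only [Matrix.mul_apply, hM, Matrix.of_apply, Finset.mul_sum]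
    rw [Finset.sum_comm]
    refine Finset.sum_congr rfl fun m _ => ?_
    have h := congrArg (ξ m * ·) (key m q)
    simp only [Finset.mul_sum] at h
    convert h using 2 <;> ring
  have hij := congrFun (congrFun hgM i) j
  rw [Matrix.mul_apply] at hij
  simp only [hrow, Matrix.of_apply] at hij
  rw [hij]
  simp only [Finset.mul_sum, Finset.sum_mul]
  rw [Finset.sum_comm]
  refine Finset.sum_congr rfl fun m _ => ?_
  rw [Finset.sum_comm]
  refine Finset.sum_congr rfl fun p _ => Finset.sum_congr rfl fun q _ => ?_
  ring
end

section
/- For all a ∈ ℝ⁶ and all indices m, k, s ∈ {1, …, 6}, the Monge condition ∂g_{mk}/∂a^s + ∂g_{ks}/∂a^m + ∂g_{ms}/∂a^k = 0 holds; i.e. g is a Monge metric. -/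
open scoped BigOperators

/-- The Monge metric of the third-order Hamiltonian operator of the 4-dimensional
WDVV associativity equations (coordinates a¹,…,a⁶ ↦ `a 0, …, a 5`). -/
noncomputable def gW (a : Fin 6 → ℝ) : Matrix (Fin 6) (Fin 6) ℝ :=
  !![(a 3)^2, -2*a 4, 2*a 3, -(a 0*a 3 + a 2), a 1, 1;
     -2*a 4, -2*a 2, a 1, 0, a 0, 0;
     2*a 3, a 1, 2, -a 0, 0, 0;
     -(a 0*a 3 + a 2), 0, -a 0, (a 0)^2, 0, 0;
     a 1, a 0, 0, 0, 0, 0;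
     1, 0, 0, 0, 0, 0]

/-- The directional derivative of `gW` at `a` along `v`. -/
def gWDeriv (a v : Fin 6 → ℝ) : Matrix (Fin 6) (Fin 6) ℝ :=
  !![2 * a 3 * v 3, -2 * v 4, 2 * v 3, -(a 0 * v 3 + a 3 * v 0 + v 2), v 1, 0;
     -2 * v 4, -2 * v 2, v 1, 0, v 0, 0;
     2 * v 3, v 1, 0, -v 0, 0, 0;
     -(a 0 * v 3 + a 3 * v 0 + v 2), 0, -v 0, 2 * a 0 * v 0, 0, 0;
     v 1, v 0, 0, 0, 0, 0;
     0, 0, 0, 0, 0, 0]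

theorem fderiv_gW_apply (a v : Fin 6 → ℝ) (i j : Fin 6) :
    fderiv ℝ (fun a' => gW a' i j) a v = gWDeriv a v i j := by
  have h (l : Fin 6) : HasFDerivAt (fun a' : Fin 6 → ℝ => a' l)
      (ContinuousLinearMap.proj (R := ℝ) (φ := fun _ : Fin 6 => ℝ) l) a := hasFDerivAt_apply l a
  have hpow (l : Fin 6) := ((h l).pow 2).fderiv
  have hlin (c : ℝ) (l : Fin 6) := ((h l).const_mul c).fderiv
  have hneg := (h 0).neg.fderiv
  have hmul := (((h 0).mul (h 3)).add (h 2)).neg.fderiv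
  have hproj (l : Fin 6) := (h l).fderiv
  simp only [Pi.neg_def, Pi.add_def, Pi.mul_def] at hlin hneg hmul
  fin_cases i <;> fin_cases j <;>
    simp [gW, gWDeriv, hpow, hlin, hneg, hmul, hproj, -neg_mul, -neg_add_rev,
      -fderiv_fun_neg] <;> ring

/-- The WDVV metric g is a Monge metric:
∂g_{mk}/∂a^s + ∂g_{ks}/∂a^m + ∂g_{ms}/∂a^k = 0. -/
theorem gW_is_monge :
    ∀ (a : Fin 6 → ℝ) (m k s : Fin 6),
      fderiv ℝ (fun a' => gW a' m k) a (Pi.single s 1)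
        + fderiv ℝ (fun a' => gW a' k s) a (Pi.single m 1)
        + fderiv ℝ (fun a' => gW a' m s) a (Pi.single k 1) = 0 := by
  intro a m k s
  simp only [fderiv_gW_apply]
  fin_cases m <;> fin_cases k <;> fin_cases s <;> simp [gWDeriv] <;> ring
end

section
/- For every a ∈ ℝ⁶ with a¹ ≠ 0, the matrix g(a) is invertible and, denoting its inverse entries by g^{pq}(a), the nonlinear Potemin equation ∂²g_{mk}/∂a^s∂a^l − ∂²g_{ms}/∂a^k∂a^l = −(1/3) g^{pq} (∂g_{pl}/∂a^m − ∂g_{pm}/∂a^l)(∂g_{qk}/∂a^s − ∂g_{qs}/∂a^k) holds for all indices m, k, s, l ∈ {1, …, 6} (summation over p, q). Hence g determines a Dubrovin–Novikov type third-order Hamiltonian operator in canonical form with respect to the Casimir coordinates a¹, …, a⁶. -/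
open scoped BigOperators

/-- The directional derivative of `gW` at `a` along `v`. -/
def dgW (a v : Fin 6 → ℝ) : Matrix (Fin 6) (Fin 6) ℝ :=
  !![2*a 3*v 3, -2*v 4, 2*v 3, -(a 0*v 3 + a 3*v 0 + v 2), v 1, 0;
     -2*v 4, -2*v 2, v 1, 0, v 0, 0;
     2*v 3, v 1, 0, -v 0, 0, 0;
     -(a 0*v 3 + a 3*v 0 + v 2), 0, -v 0, 2*a 0*v 0, 0, 0;
     v 1, v 0, 0, 0, 0, 0;
     0, 0, 0, 0, 0, 0]

/-- The second directional derivative of `gW` along `v` and `w`; it does not depend on the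
base point because the entries of `gW` are quadratic polynomials. -/
def ddgW (v w : Fin 6 → ℝ) : Matrix (Fin 6) (Fin 6) ℝ :=
  !![2*w 3*v 3, 0, 0, -(w 0*v 3 + w 3*v 0), 0, 0;
     0, 0, 0, 0, 0, 0;
     0, 0, 0, 0, 0, 0;
     -(w 0*v 3 + w 3*v 0), 0, 0, 2*w 0*v 0, 0, 0;
     0, 0, 0, 0, 0, 0;
     0, 0, 0, 0, 0, 0]

/-- The inverse matrix of `gW a`, valid where `a 0 ≠ 0`. -/
noncomputable def invgW (a : Fin 6 → ℝ) : Matrix (Fin 6) (Fin 6) ℝ :=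
  !![0, 0, 0, 0, 0, 1;
     0, 0, 0, 0, 1/a 0, -a 1/a 0;
     0, 0, 1, 1/a 0, -a 1/a 0, (a 1^2 + a 2)/a 0 - a 3;
     0, 0, 1/a 0, 2/a 0^2, -a 1/a 0^2, (a 1^2 + 2*a 2)/a 0^2;
     0, 1/a 0, -a 1/a 0, -a 1/a 0^2, (a 1^2 + 2*a 2)/a 0^2,
       a 1/a 0*(a 3 - (a 1^2 + a 2)/a 0) + 2*a 4/a 0 - 2*a 1*a 2/a 0^2;
     1, -a 1/a 0, (a 1^2 + a 2)/a 0 - a 3, (a 1^2 + 2*a 2)/a 0^2,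
       a 1/a 0*(a 3 - (a 1^2 + a 2)/a 0) + 2*a 4/a 0 - 2*a 1*a 2/a 0^2,
       (2*a 3 - a 1^2/a 0)*(a 3 - (a 1^2 + a 2)/a 0)
         + (a 0*a 3 + a 2)*(a 1^2 + 2*a 2)/a 0^2 - a 3^2 - 4*a 1*a 4/a 0
         + 2*a 1^2*a 2/a 0^2]

theorem gW_mul_invgW {a : Fin 6 → ℝ} (ha : a 0 ≠ 0) : gW a * invgW a = 1 := by
  ext i j
  fin_cases i <;> fin_cases j <;>
    simp [gW, invgW, Matrix.mul_apply, Fin.sum_univ_six] <;>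
    field_simp <;> ring

theorem gW_add_smul (a v : Fin 6 → ℝ) (t : ℝ) (i j : Fin 6) :
    gW (a + t • v) i j = gW a i j + t * dgW a v i j + t ^ 2 * (ddgW v v i j / 2) := by
  fin_cases i <;> fin_cases j <;> simp [gW, dgW, ddgW] <;> ring

theorem dgW_add_smul (a v w : Fin 6 → ℝ) (t : ℝ) (i j : Fin 6) :
    dgW (a + t • w) v i j = dgW a v i j + t * ddgW v w i j := by
  fin_cases i <;> fin_cases j <;> simp [dgW, ddgW] <;> ring

theorem differentiable_gW (i j : Fin 6) : Differentiable ℝ (fun c => gW c i j) := by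
  fin_cases i <;> fin_cases j <;> simp [gW] <;> fun_prop

theorem differentiable_dgW (v : Fin 6 → ℝ) (i j : Fin 6) :
    Differentiable ℝ (fun c => dgW c v i j) := by
  fin_cases i <;> fin_cases j <;> simp [dgW] <;> fun_prop

/-- A differentiable function whose restriction to a line through `a` is quadratic in the
parameter has the linear coefficient as its directional derivative. -/
theorem fderiv_apply_of_quadratic {f : (Fin 6 → ℝ) → ℝ} {a v : Fin 6 → ℝ} {b c : ℝ}
    (hf : DifferentiableAt ℝ f a) (h : ∀ t : ℝ, f (a + t • v) = f a + t * b + t ^ 2 * c) :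
    fderiv ℝ f a v = b := by
  rw [← hf.lineDeriv_eq_fderiv]
  have hd : HasDerivAt (fun t : ℝ => f a + t * b + t ^ 2 * c) b 0 := by
    have h1 := (((hasDerivAt_id (0 : ℝ)).mul_const b).const_add (f a)).fun_add
      (((hasDerivAt_id (0 : ℝ)).fun_pow 2).mul_const c)
    simpa using h1
  have hl : HasLineDerivAt ℝ f b a v := by
    simpa only [HasLineDerivAt, h] using hd
  exact hl.lineDeriv

theorem fderiv_gW (a v : Fin 6 → ℝ) (i j : Fin 6) :
    fderiv ℝ (fun c => gW c i j) a v = dgW a v i j :=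
  fderiv_apply_of_quadratic (differentiable_gW i j a) fun t => gW_add_smul a v t i j

theorem fderiv_dgW (a v w : Fin 6 → ℝ) (i j : Fin 6) :
    fderiv ℝ (fun c => dgW c v i j) a w = ddgW v w i j :=
  fderiv_apply_of_quadratic (c := 0) (differentiable_dgW v i j a) fun t => by
    rw [dgW_add_smul, mul_zero, add_zero]

/-- A row of a matrix, expanded in the standard basis. -/
theorem apply_eq_sum_single (f : Fin 6 → ℝ) (l : Fin 6) :
    f l = ∑ j, f j * (Pi.single l 1 : Fin 6 → ℝ) j := by
  simp [Pi.single_apply]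

/-- The antisymmetrised first derivatives of `gW`, in terms of the minors of two basis
vectors. -/
def curlgW (a u v : Fin 6 → ℝ) : Fin 6 → ℝ :=
  ![-3 * a 3 * (u 3 * v 0 - u 0 * v 3) - 3 * (u 3 * v 2 - u 2 * v 3)
      + 3 * (u 4 * v 1 - u 1 * v 4),
    3 * (u 2 * v 1 - u 1 * v 2) + 3 * (u 4 * v 0 - u 0 * v 4),
    -3 * (u 3 * v 0 - u 0 * v 3),
    3 * a 0 * (u 3 * v 0 - u 0 * v 3), 0, 0]

theorem dgW_sub_dgW (a : Fin 6 → ℝ) (p l m : Fin 6) :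
    dgW a (Pi.single m 1) p l - dgW a (Pi.single l 1) p m
      = curlgW a (Pi.single l 1) (Pi.single m 1) p := by
  rw [apply_eq_sum_single (dgW a (Pi.single m 1) p) l,
    apply_eq_sum_single (dgW a (Pi.single l 1) p) m]
  generalize (Pi.single m 1 : Fin 6 → ℝ) = v
  generalize (Pi.single l 1 : Fin 6 → ℝ) = u
  fin_cases p <;> simp [dgW, curlgW, Fin.sum_univ_six] <;> ring

theorem ddgW_apply (v w : Fin 6 → ℝ) (m k : Fin 6) :
    ddgW v w m k = ∑ i, ∑ j, ddgW v w i j * (Pi.single k 1 : Fin 6 → ℝ) j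
      * (Pi.single m 1 : Fin 6 → ℝ) i := by
  simp [Pi.single_apply]

theorem sum_invgW_curlgW {a : Fin 6 → ℝ} (ha : a 0 ≠ 0) (u v u' v' : Fin 6 → ℝ) :
    ∑ p, ∑ q, invgW a p q * curlgW a u v p * curlgW a u' v' q
      = 9 * (u 3 * v 0 - u 0 * v 3) * (u' 3 * v' 0 - u' 0 * v' 3) := by
  simp [invgW, curlgW, Fin.sum_univ_six]
  field_simp
  ring

theorem ddgW_sub_ddgW (m k s l : Fin 6) :
    ddgW (Pi.single s 1) (Pi.single l 1) m k - ddgW (Pi.single k 1) (Pi.single l 1) m s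
      = -(1/3) * (9
        * ((Pi.single l 1 : Fin 6 → ℝ) 3 * (Pi.single m 1 : Fin 6 → ℝ) 0
          - (Pi.single l 1 : Fin 6 → ℝ) 0 * (Pi.single m 1 : Fin 6 → ℝ) 3)
        * ((Pi.single k 1 : Fin 6 → ℝ) 3 * (Pi.single s 1 : Fin 6 → ℝ) 0
          - (Pi.single k 1 : Fin 6 → ℝ) 0 * (Pi.single s 1 : Fin 6 → ℝ) 3)) := by
  rw [ddgW_apply _ _ m k, ddgW_apply _ _ m s]
  generalize (Pi.single m 1 : Fin 6 → ℝ) = em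
  generalize (Pi.single k 1 : Fin 6 → ℝ) = ek
  generalize (Pi.single s 1 : Fin 6 → ℝ) = es
  generalize (Pi.single l 1 : Fin 6 → ℝ) = el
  simp [ddgW, Fin.sum_univ_six]
  ring

/-- The WDVV Monge metric satisfies the nonlinear Potemin equation wherever a¹ ≠ 0,
hence it determines a Dubrovin–Novikov type third-order Hamiltonian operator in
canonical (Casimir) coordinates. -/
theorem gW_satisfies_potemin :
    ∀ a : Fin 6 → ℝ, a 0 ≠ 0 →
      IsUnit (gW a) ∧
      ∀ m k s l : Fin 6,
        fderiv ℝ (fun b => fderiv ℝ (fun c => gW c m k) b (Pi.single s 1)) a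
            (Pi.single l 1)
          - fderiv ℝ (fun b => fderiv ℝ (fun c => gW c m s) b (Pi.single k 1)) a
            (Pi.single l 1)
        = -(1/3) * ∑ p, ∑ q, (gW a)⁻¹ p q *
            (fderiv ℝ (fun c => gW c p l) a (Pi.single m 1)
              - fderiv ℝ (fun c => gW c p m) a (Pi.single l 1)) *
            (fderiv ℝ (fun c => gW c q k) a (Pi.single s 1)
              - fderiv ℝ (fun c => gW c q s) a (Pi.single k 1)) := by
  intro a ha
  refine ⟨IsUnit.of_mul_eq_one _ (gW_mul_invgW ha), fun m k s l => ?_⟩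
  simp only [fderiv_gW, fderiv_dgW, dgW_sub_dgW, Matrix.inv_eq_right_inv (gW_mul_invgW ha),
    sum_invgW_curlgW ha, ddgW_sub_ddgW]
end

section
/- For every a ∈ ℝ⁶ with a¹ ≠ 0 and every γ ∈ {1, …, 6}, the contractions Σ_m ψ^γ_m(a) v^m(a) and Σ_m ψ^γ_m(a) w^m(a) are linear in a: Σ_m ψ^γ_m(a) v^m(a) = Σ_m (η₁)^γ_m a^m and Σ_m ψ^γ_m(a) w^m(a) = Σ_m (η₂)^γ_m a^m, where η₁ is the constant 6×6 matrix (row index γ, column index m) with rows (0,1,0,0,0,0), (0,0,0,0,0,−1), (0,0,0,0,−2,0), (0,0,0,1,0,0), (0,0,0,0,0,0), (0,0,0,0,1,0), and η₂ is the constant 6×6 matrix with rows (0,0,1,0,0,0), (0,0,0,0,0,0), (0,0,0,0,0,−1), (0,0,0,0,1,0), (0,0,0,0,0,0), (0,0,0,0,0,1). -/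
open scoped BigOperators

/-- The matrix Ψ(a) = (ψ^γ_i(a)) (row index i, column index γ). -/
noncomputable def ΨW (a : Fin 6 → ℝ) : Matrix (Fin 6) (Fin 6) ℝ :=
  !![1, a 4, a 3, 0, 0, 0;
     0, a 2, 0, 1, a 4, 0;
     0, -a 1, 0, 0, -a 3, 1;
     0, 0, -a 0, 0, a 2, 0;
     0, -a 0, 0, 0, -a 1, 0;
     0, 0, 0, 0, -1, 0]

/-- The velocity v(a) of the first six-component WDVV hydrodynamic type system. -/
noncomputable def vW (a : Fin 6 → ℝ) : Fin 6 → ℝ :=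
  ![a 1, a 3, a 4, (2*a 4 + a 1*a 3)/a 0, (a 2*a 3 + a 5)/a 0,
    (2*a 2*a 4 - a 1*a 5)/a 0]

/-- The velocity w(a) of the second six-component WDVV hydrodynamic type system. -/
noncomputable def wW (a : Fin 6 → ℝ) : Fin 6 → ℝ :=
  ![a 2, a 4, a 5, (a 2*a 3 + a 5)/a 0, (2*a 2*a 4 - a 1*a 5)/a 0,
    (a 4)^2 - a 3*a 5 + ((a 2)^2*a 3 + a 2*a 5 - 2*a 1*a 2*a 4 + (a 1)^2*a 5)/a 0]

/-- The constant matrix η₁ (row index γ, column index m). -/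
noncomputable def η₁W : Matrix (Fin 6) (Fin 6) ℝ :=
  !![0, 1, 0, 0, 0, 0;
     0, 0, 0, 0, 0, -1;
     0, 0, 0, 0, -2, 0;
     0, 0, 0, 1, 0, 0;
     0, 0, 0, 0, 0, 0;
     0, 0, 0, 0, 1, 0]

/-- The constant matrix η₂ (row index γ, column index m). -/
noncomputable def η₂W : Matrix (Fin 6) (Fin 6) ℝ :=
  !![0, 0, 1, 0, 0, 0;
     0, 0, 0, 0, 0, 0;
     0, 0, 0, 0, 0, -1;
     0, 0, 0, 0, 1, 0;
     0, 0, 0, 0, 0, 0;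
     0, 0, 0, 0, 0, 1]

/-- The contractions ψ^γ_m(a) v^m(a) and ψ^γ_m(a) w^m(a) are linear in a,
with constant matrices η₁, η₂. -/
theorem wdvv_eta_linearity :
    ∀ a : Fin 6 → ℝ, a 0 ≠ 0 → ∀ γ : Fin 6,
      (∑ m, ΨW a m γ * vW a m) = (∑ m, η₁W γ m * a m) ∧
      (∑ m, ΨW a m γ * wW a m) = (∑ m, η₂W γ m * a m) := by
  intro a ha γ
  fin_cases γ <;> constructor <;>
    simp [Fin.sum_univ_succ, ΨW, vW, wW, η₁W, η₂W] <;>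
    field_simp <;> ring
end

section
/- If ψ: U → ℝⁿ is a C² map (components ψ_j) satisfying the parallel-section equation ∂ψ_j/∂a^k = (1/3) ψ_p g^{pq} (∂g_{qj}/∂a^k − ∂g_{qk}/∂a^j) on U (summation over p, q), then all second-order partial derivatives of ψ vanish identically on U: ∂²ψ_j/∂a^k∂a^m = 0 for all j, k, m. In particular, on each connected component of U every solution ψ is an affine function of the coordinates a¹, …, aⁿ. -/
open scoped BigOperators

/-- The entries of the inverse of a differentiable family of invertible matrices are
differentiable. -/
theorem differentiableAt_matrix_inv_apply_s17 {E ι : Type*} [NormedAddCommGroup E]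
    [NormedSpace ℝ E] [Fintype ι] [DecidableEq ι] {A : E → Matrix ι ι ℝ} {a : E}
    (hA : ∀ i j, DifferentiableAt ℝ (fun b => A b i j) a) (ha : IsUnit (A a)) (i j : ι) :
    DifferentiableAt ℝ (fun b => (A b)⁻¹ i j) a := by
  have hdet : ∀ B : E → Matrix ι ι ℝ, (∀ i j, DifferentiableAt ℝ (fun b => B b i j) a) →
      DifferentiableAt ℝ (fun b => (B b).det) a := by
    intro B hB
    simp only [Matrix.det_apply']
    refine DifferentiableAt.fun_sum fun σ _ => ?_
    exact (HasFDerivAt.finsetProd fun i _ => (hB (σ i) i).hasFDerivAt).differentiableAt.const_mul _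
  have h0 : (A a).det ≠ 0 := ((Matrix.isUnit_iff_isUnit_det _).1 ha).ne_zero
  simp only [Matrix.inv_def, Ring.inverse_eq_inv', Matrix.smul_apply, smul_eq_mul,
    Matrix.adjugate_apply]
  refine ((hdet A hA).inv h0).mul (hdet _ fun k l => ?_)
  simp only [Matrix.updateRow_apply]
  split_ifs
  · exact differentiableAt_const _
  · exact hA k l

/-- A continuous linear functional on `ι → ℝ` vanishing on the standard basis is zero. -/
theorem continuousLinearMap_pi_eq_zero {ι : Type*} [Finite ι] [DecidableEq ι]
    {T : (ι → ℝ) →L[ℝ] ℝ} (h : ∀ i, T (Pi.single i 1) = 0) : T = 0 := by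
  refine ContinuousLinearMap.coe_injective (LinearMap.pi_ext' fun i => LinearMap.ext_ring ?_)
  simpa using h i

/-- A function on an open set whose second-order partial derivatives vanish is affine on every
connected subset. -/
theorem exists_affine_of_second_partial_eq_zero {ι : Type*} [Fintype ι] [DecidableEq ι]
    {U : Set (ι → ℝ)} (hU : IsOpen U) {f : (ι → ℝ) → ℝ} (hf : ContDiffOn ℝ 2 f U)
    (h : ∀ a ∈ U, ∀ k m,
      fderiv ℝ (fun b => fderiv ℝ f b (Pi.single k 1)) a (Pi.single m 1) = 0)
    {s : Set (ι → ℝ)} (hsU : s ⊆ U) (hs : IsConnected s) :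
    ∃ (L : ι → ℝ) (v : ℝ), ∀ a ∈ s, f a = (∑ m, L m * a m) + v := by
  obtain ⟨x, hx⟩ := hs.nonempty
  set C := connectedComponentIn U x with hC
  have hCU : C ⊆ U := connectedComponentIn_subset U x
  have hCo : IsOpen C := hU.connectedComponentIn
  have hCp : IsPreconnected C := isPreconnected_connectedComponentIn
  have hsC : s ⊆ C := hs.isPreconnected.subset_connectedComponentIn hx hsU
  have hf' : DifferentiableOn ℝ (fderiv ℝ f) U :=
    (hf.fderiv_of_isOpen hU (m := 1) (by norm_num)).differentiableOn (by norm_num)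
  have hconst : ∀ k, ∀ a ∈ C, fderiv ℝ f a (Pi.single k 1) = fderiv ℝ f x (Pi.single k 1) := by
    intro k a ha
    refine hCo.is_const_of_fderiv_eq_zero (𝕜 := ℝ) (f := fun b => fderiv ℝ f b (Pi.single k 1)) hCp
      ((hf'.mono hCU).clm_apply (differentiableOn_const _)) (fun b hb => ?_) ha (hsC hx)
    exact continuousLinearMap_pi_eq_zero (h b (hCU hb) k)
  set T := fderiv ℝ f x
  have hfd : DifferentiableOn ℝ f C := (hf.differentiableOn (by norm_num)).mono hCU
  refine ⟨fun m => T (Pi.single m 1), f x - T x, fun a ha => ?_⟩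
  have hsub : f a - T a = f x - T x := by
    refine hCo.is_const_of_fderiv_eq_zero (𝕜 := ℝ) (f := fun b => f b - T b) hCp
      (hfd.sub T.differentiable.differentiableOn) (fun b hb => ?_) (hsC ha) (hsC hx)
    refine continuousLinearMap_pi_eq_zero fun k => ?_
    rw [fderiv_fun_sub (hfd.differentiableAt (hCo.mem_nhds hb)) T.differentiableAt, T.fderiv]
    simp [hconst k b hb]
  have hT : T a = ∑ m, T (Pi.single m 1) * a m := by
    refine (T.toLinearMap.pi_apply_eq_sum_univ a).trans (Finset.sum_congr rfl fun m _ => ?_)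
    have hm : (fun j => if m = j then (1 : ℝ) else 0) = Pi.single m 1 := by
      ext j
      simp [Pi.single_apply, eq_comm]
    simp [hm, mul_comm]
  rw [← hT]
  linarith

/-- Parallel sections of the connection determined by a Monge metric satisfying the
Potemin system are affine functions of the flat (Casimir) coordinates. -/
theorem parallel_sections_are_affine
    (n : ℕ) (hn : 1 ≤ n)
    (U : Set (Fin n → ℝ)) (hU : IsOpen U)
    (g : (Fin n → ℝ) → Matrix (Fin n) (Fin n) ℝ)
    (hgsmooth : ∀ i j, ContDiffOn ℝ (⊤ : ℕ∞) (fun a => g a i j) U)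
    (hgsym : ∀ a ∈ U, ∀ i j, g a i j = g a j i)
    (hgunit : ∀ a ∈ U, IsUnit (g a))
    -- c_{skm} = (1/3)(∂g_{sm}/∂a^k − ∂g_{sk}/∂a^m)
    (c : Fin n → Fin n → Fin n → (Fin n → ℝ) → ℝ)
    (hc : ∀ s k m (a : Fin n → ℝ), c s k m a =
      (1/3) * (fderiv ℝ (fun b => g b s m) a (Pi.single k 1)
                - fderiv ℝ (fun b => g b s k) a (Pi.single m 1)))
    -- the Monge condition on U
    (hmonge : ∀ a ∈ U, ∀ m k s,
      fderiv ℝ (fun b => g b m k) a (Pi.single s 1)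
        + fderiv ℝ (fun b => g b k s) a (Pi.single m 1)
        + fderiv ℝ (fun b => g b m s) a (Pi.single k 1) = 0)
    -- the nonlinear Potemin condition on U
    (hpotemin : ∀ a ∈ U, ∀ m s k l,
      fderiv ℝ (c m s k) a (Pi.single l 1)
        = - ∑ p, ∑ q, (g a)⁻¹ p q * c p m l a * c q s k a)
    -- a C² solution of the parallel-section equation on U
    (ψ : (Fin n → ℝ) → Fin n → ℝ)
    (hψC2 : ∀ j, ContDiffOn ℝ 2 (fun a => ψ a j) U)
    (hψpar : ∀ a ∈ U, ∀ j k,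
      fderiv ℝ (fun b => ψ b j) a (Pi.single k 1)
        = (1/3) * ∑ p, ∑ q, ψ a p * (g a)⁻¹ p q *
            (fderiv ℝ (fun b => g b q j) a (Pi.single k 1)
              - fderiv ℝ (fun b => g b q k) a (Pi.single j 1))) :
    -- all second-order partial derivatives of ψ vanish on U
    (∀ a ∈ U, ∀ j k m,
      fderiv ℝ (fun b => fderiv ℝ (fun c' => ψ c' j) b (Pi.single k 1)) a
        (Pi.single m 1) = 0)
    ∧
    -- in particular, ψ is affine on every connected subset of U
    (∀ s : Set (Fin n → ℝ), s ⊆ U → IsConnected s →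
      ∃ (L : Matrix (Fin n) (Fin n) ℝ) (v : Fin n → ℝ),
        ∀ a ∈ s, ∀ j, ψ a j = (∑ m, L j m * a m) + v j) := by
  have hgd : ∀ a ∈ U, ∀ i j, DifferentiableAt ℝ (fun b => g b i j) a := fun a ha i j =>
    ((hgsmooth i j).differentiableOn (by simp)).differentiableAt (hU.mem_nhds ha)
  have hgd2 : ∀ a ∈ U, ∀ i j, DifferentiableAt ℝ (fderiv ℝ (fun b => g b i j)) a :=
    fun a ha i j => (((hgsmooth i j).fderiv_of_isOpen hU (m := 1)
      (WithTop.coe_le_coe.2 le_top)).differentiableOn (by norm_num)).differentiableAt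
        (hU.mem_nhds ha)
  have hcd : ∀ a ∈ U, ∀ s k m, DifferentiableAt ℝ (c s k m) a := by
    intro a ha s k m
    rw [show c s k m = _ from funext (hc s k m)]
    exact (((hgd2 a ha s m).clm_apply (differentiableAt_const _)).sub
      ((hgd2 a ha s k).clm_apply (differentiableAt_const _))).const_mul _
  have hψd : ∀ a ∈ U, ∀ j, DifferentiableAt ℝ (fun b => ψ b j) a := fun a ha j =>
    ((hψC2 j).differentiableOn (by norm_num)).differentiableAt (hU.mem_nhds ha)
  -- raise the index of `ψ`
  set φ : (Fin n → ℝ) → Fin n → ℝ := fun b q => ∑ p, ψ b p * (g b)⁻¹ p q with hφ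
  have hφd : ∀ a ∈ U, ∀ q, DifferentiableAt ℝ (fun b => φ b q) a := fun a ha q =>
    DifferentiableAt.fun_sum fun p _ =>
      (hψd a ha p).mul (differentiableAt_matrix_inv_apply_s17 (hgd a ha) (hgunit a ha) p q)
  have hψφ : ∀ a ∈ U, ∀ p, ψ a p = ∑ q, φ a q * g a q p := by
    intro a ha p
    have h1 : (g a)⁻¹ * g a = 1 :=
      Matrix.nonsing_inv_mul _ ((Matrix.isUnit_iff_isUnit_det _).1 (hgunit a ha))
    have h2 : Matrix.vecMul (Matrix.vecMul (ψ a) (g a)⁻¹) (g a) = ψ a := by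
      rw [Matrix.vecMul_vecMul, h1, Matrix.vecMul_one]
    exact (congrFun h2 p).symm
  have hpar : ∀ a ∈ U, ∀ j k,
      fderiv ℝ (fun b => ψ b j) a (Pi.single k 1) = ∑ q, φ a q * c q k j a := by
    intro a ha j k
    rw [hψpar a ha j k, Finset.sum_comm, Finset.mul_sum]
    refine Finset.sum_congr rfl fun q _ => ?_
    rw [hc, hφ, Finset.sum_mul, Finset.mul_sum]
    exact Finset.sum_congr rfl fun p _ => by ring
  have hD : ∀ a ∈ U, ∀ (F : Fin n → (Fin n → ℝ) → ℝ) (_ : ∀ q, DifferentiableAt ℝ (F q) a) m,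
      fderiv ℝ (fun b => ∑ q, φ b q * F q b) a (Pi.single m 1)
        = (∑ q, fderiv ℝ (fun b => φ b q) a (Pi.single m 1) * F q a)
          + ∑ q, φ a q * fderiv ℝ (F q) a (Pi.single m 1) := by
    intro a ha F hF m
    rw [fderiv_fun_sum fun q _ => (hφd a ha q).fun_mul (hF q), _root_.sum_apply,
      ← Finset.sum_add_distrib]
    refine Finset.sum_congr rfl fun q _ => ?_
    rw [fderiv_fun_mul (hφd a ha q) (hF q)]
    simp only [_root_.add_apply, _root_.smul_apply, smul_eq_mul]
    ring
  have hφg : ∀ a ∈ U, ∀ m p,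
      ∑ q, fderiv ℝ (fun b => φ b q) a (Pi.single m 1) * g a q p
        = ∑ q, φ a q * c p q m a := by
    intro a ha m p
    have h1 := hD a ha (fun q b => g b q p) (fun q => hgd a ha q p) m
    have h2 : (fun b => ψ b p) =ᶠ[nhds a] fun b => ∑ q, φ b q * g b q p :=
      Filter.eventually_of_mem (hU.mem_nhds ha) fun b hb => hψφ b hb p
    rw [← h2.fderiv_eq, hpar a ha] at h1
    rw [← sub_eq_iff_eq_add.2 h1, ← Finset.sum_sub_distrib]
    refine Finset.sum_congr rfl fun q _ => ?_
    have h3 : (fun b => g b p q) =ᶠ[nhds a] fun b => g b q p :=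
      Filter.eventually_of_mem (hU.mem_nhds ha) fun b hb => hgsym b hb p q
    have h4 := hmonge a ha q p m
    rw [hc, hc, h3.fderiv_eq]
    linear_combination (-(1 / 3) * φ a q) * h4
  have hφ' : ∀ a ∈ U, ∀ m r, fderiv ℝ (fun b => φ b r) a (Pi.single m 1)
      = ∑ p, (∑ q, φ a q * c p q m a) * (g a)⁻¹ p r := by
    intro a ha m r
    have h1 : g a * (g a)⁻¹ = 1 :=
      Matrix.mul_nonsing_inv _ ((Matrix.isUnit_iff_isUnit_det _).1 (hgunit a ha))
    set w : Fin n → ℝ := fun q => fderiv ℝ (fun b => φ b q) a (Pi.single m 1) with hw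
    have h2 : Matrix.vecMul (Matrix.vecMul w (g a)) (g a)⁻¹ = w := by
      rw [Matrix.vecMul_vecMul, h1, Matrix.vecMul_one]
    have h3 : Matrix.vecMul w (g a) = fun p => ∑ q, φ a q * c p q m a :=
      funext fun p => hφg a ha m p
    rw [h3] at h2
    exact (congrFun h2 r).symm
  have hsecond : ∀ a ∈ U, ∀ j k m,
      fderiv ℝ (fun b => fderiv ℝ (fun c' => ψ c' j) b (Pi.single k 1)) a
        (Pi.single m 1) = 0 := by
    intro a ha j k m
    have h1 : (fun b => fderiv ℝ (fun c' => ψ c' j) b (Pi.single k 1)) =ᶠ[nhds a]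
        fun b => ∑ q, φ b q * c q k j b :=
      Filter.eventually_of_mem (hU.mem_nhds ha) fun b hb => hpar b hb j k
    rw [h1.fderiv_eq, hD a ha (fun q => c q k j) (fun q => hcd a ha q k j)]
    simp only [hφ' a ha, hpotemin a ha, mul_neg, Finset.sum_neg_distrib, Finset.sum_mul,
      Finset.mul_sum]
    rw [add_neg_eq_zero, Finset.sum_comm, Finset.sum_comm_cycle]
    refine Finset.sum_congr rfl fun q _ => ?_
    refine Finset.sum_congr rfl fun p _ => ?_
    refine Finset.sum_congr rfl fun r _ => ?_
    ring
  refine ⟨hsecond, fun s hsU hs => ?_⟩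
  choose L v hLv using fun j => exists_affine_of_second_partial_eq_zero hU (hψC2 j)
    (fun a ha => hsecond a ha j) hsU hs
  exact ⟨L, v, fun a ha j => hLv j a ha⟩
end
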